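/- arXiv:2001.05593 — 6 statements merged into one kernel-verified Lean document; each statement's English description precedes it below -/
import Mathlib

section
/- Let A be a C*-algebra. The following conditions are equivalent: (i) A has the centre-quotient (CQ) property; (ii) for every surjective *-homomorphism φ : A → B onto another C*-algebra B, φ(Z(A)) = Z(B); (iii) for every a ∈ A, a ∈ Z(A) + Id_A([a,A]), where [a,A] = {ax − xa : x ∈ A} and Id_A([a,A]) is the closed two-sided ideal of A generated by [a,A]. -/
open Filter Topology Pointwise

namespace CQP

variable {R : Type*} [NonUnitalRing R] [TopologicalSpace R]

/-- `I` is a closed two-sided ideal of the (C*-)algebra `S` (a subset of the ambient algebra). -/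
def IsIdealOf (I S : Set R) : Prop :=
  I ⊆ S ∧ IsClosed I ∧ (0 : R) ∈ I ∧
  (∀ x ∈ I, ∀ y ∈ I, x + y ∈ I) ∧ (∀ x ∈ I, -x ∈ I) ∧
  (∀ x ∈ I, ∀ a ∈ S, a * x ∈ I ∧ x * a ∈ I)

/-- The centre of the algebra `S`. -/
def centerOf (S : Set R) : Set R := {z ∈ S | ∀ x ∈ S, z * x = x * z}

/-- `e` is a unit for `S` relative to (modulo) the ideal `M`. -/
def IsRelUnitMod (S M : Set R) (e : R) : Prop :=
  e ∈ S ∧ ∀ x ∈ S, x - x * e ∈ M ∧ x - e * x ∈ M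

/-- `M` is a modular maximal ideal of the algebra `S`. -/
def IsModMaxIdealOf (M S : Set R) : Prop :=
  IsIdealOf M S ∧ M ≠ S ∧
  (∀ I, IsIdealOf I S → M ⊆ I → I = M ∨ I = S) ∧
  ∃ e, IsRelUnitMod S M e

/-- The algebra `S` is weakly central. -/
def WeaklyCentral (S : Set R) : Prop :=
  (∀ M, IsModMaxIdealOf M S → ¬ centerOf S ⊆ M) ∧
  (∀ M N, IsModMaxIdealOf M S → IsModMaxIdealOf N S →
    M ∩ centerOf S = N ∩ centerOf S → M = N)

/-- The algebra `S` has the centre-quotient property: every central element of a quotient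
of `S` lifts to a central element of `S` modulo the ideal. -/
def HasCQ (S : Set R) : Prop :=
  ∀ I, IsIdealOf I S → ∀ a ∈ S, (∀ x ∈ S, a * x - x * a ∈ I) →
    ∃ z ∈ centerOf S, a - z ∈ I

/-- `a` is a CQ-element of the algebra `S`. -/
def IsCQElem (S : Set R) (a : R) : Prop :=
  a ∈ S ∧ ∀ I, IsIdealOf I S → (∀ x ∈ S, a * x - x * a ∈ I) →
    ∃ z ∈ centerOf S, a - z ∈ I

/-- The set of CQ-elements of `S`. -/
def CQset (S : Set R) : Set R := {a | IsCQElem S a}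

/-- The set `T_A` of modular maximal ideals witnessing the failure of weak centrality. -/
def Tset (S : Set R) : Set (Set R) :=
  {M | IsModMaxIdealOf M S ∧
    (centerOf S ⊆ M ∨ ∃ N, IsModMaxIdealOf N S ∧ N ≠ M ∧
      ¬ centerOf S ⊆ M ∧ ¬ centerOf S ⊆ N ∧ M ∩ centerOf S = N ∩ centerOf S)}

/-- The closed two-sided ideal of `S` generated by the set `X`. -/
def genIdealOf (S X : Set R) : Set R := ⋂₀ {I | IsIdealOf I S ∧ X ⊆ I}

/-- The quotient `A/J` (of the full algebra by the ideal `J`) has the centre-quotient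
property, expressed via the correspondence between ideals of `A/J` and ideals of `A`
containing `J`. -/
def HasCQmod (J : Set R) : Prop :=
  ∀ I : Set R, IsIdealOf I (Set.univ : Set R) → J ⊆ I → ∀ a : R,
    (∀ x : R, a * x - x * a ∈ I) →
      ∃ z : R, (∀ x : R, z * x - x * z ∈ J) ∧ a - z ∈ I


end CQP

open CQP

namespace CQP

open scoped CStarAlgebra

section Ideal

variable {A : Type*} [NonUnitalCStarAlgebra A] {I : Set A}

lemma norm_sub_mul_sq_le {u : A} (hu : star u = u) (hc : ∀ a : A, ‖a - a * u‖ ≤ ‖a‖) (a : A) :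
    ‖a - a * u‖ * ‖a - a * u‖ ≤ ‖star a * a - star a * a * u‖ := by
  set c := star a * a - star a * a * u with hcdef
  have h : star (a - a * u) * (a - a * u) = star (star c - star c * u) := by
    simp only [hcdef, star_sub, star_mul, star_star, hu]
    noncomm_ring
  rw [← CStarRing.norm_star_mul_self, h, norm_star]
  exact (hc _).trans (norm_star c).le

lemma norm_sub_mul_le_of_nonneg [PartialOrder A] [StarOrderedRing A] {u : A} (hu : 0 ≤ u)
    (hu1 : ‖u‖ ≤ 1) (a : A) : ‖a - a * u‖ ≤ ‖a‖ := by
  have h0 : (0 : Unitization ℂ A) ≤ u := Unitization.inr_nonneg_iff.mpr hu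
  have h1 : (u : Unitization ℂ A) ∈ Set.Icc (0 : Unitization ℂ A) 1 :=
    CStarAlgebra.mem_Icc_iff_norm_le_one.mpr ⟨h0, by rwa [Unitization.norm_inr]⟩
  have h2 : ‖(1 - u : Unitization ℂ A)‖ ≤ 1 :=
    (CStarAlgebra.mem_Icc_iff_norm_le_one.mp (Set.sub_mem_Icc_zero_iff_right.mpr h1)).2
  calc ‖a - a * u‖ = ‖(a : Unitization ℂ A) * (1 - u)‖ := by
        rw [← Unitization.norm_inr (𝕜 := ℂ), Unitization.inr_sub, Unitization.inr_mul, mul_sub,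
          mul_one]
    _ ≤ ‖(a : Unitization ℂ A)‖ * ‖(1 - u : Unitization ℂ A)‖ := norm_mul_le _ _
    _ ≤ ‖(a : Unitization ℂ A)‖ := mul_le_of_le_one_right (norm_nonneg _) h2
    _ = ‖a‖ := Unitization.norm_inr _

lemma IsIdealOf.smul_mem (hI : IsIdealOf I Set.univ) (c : ℂ) {x : A} (hx : x ∈ I) :
    c • x ∈ I := by
  let _ := CStarAlgebra.spectralOrder A
  have := CStarAlgebra.spectralOrderedRing A
  have hl := CStarAlgebra.increasingApproximateUnit A
  refine hI.2.1.mem_of_tendsto (hl.tendsto_mul_left (c • x)) (.of_forall fun u ↦ ?_)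
  rw [smul_mul_assoc, ← mul_smul_comm]
  exact (hI.2.2.2.2.2 x hx _ trivial).2

/-- The self-adjoint part `I ∩ I⋆` of a closed ideal. -/
def IsIdealOf.starPart (hI : IsIdealOf I Set.univ) : NonUnitalStarSubalgebra ℂ A where
  carrier := {x | x ∈ I ∧ star x ∈ I}
  add_mem' {x y} hx hy := ⟨hI.2.2.2.1 _ hx.1 _ hy.1, by
    rw [star_add]; exact hI.2.2.2.1 _ hx.2 _ hy.2⟩
  zero_mem' := ⟨hI.2.2.1, by rw [star_zero]; exact hI.2.2.1⟩
  mul_mem' {x y} hx hy := ⟨(hI.2.2.2.2.2 x hx.1 y trivial).2, by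
    rw [star_mul]; exact (hI.2.2.2.2.2 _ hx.2 _ trivial).1⟩
  smul_mem' c x hx := ⟨hI.smul_mem c hx.1, by
    rw [star_smul]; exact hI.smul_mem _ hx.2⟩
  star_mem' {x} hx := ⟨hx.2, by rw [star_star]; exact hx.1⟩

/-- A closed ideal contains a self-adjoint contractive right approximate unit. -/
lemma IsIdealOf.exists_approximateUnit (hI : IsIdealOf I Set.univ) :
    ∃ l : Filter A, l.NeBot ∧
      (∀ᶠ u in l, u ∈ I ∧ star u = u ∧ ∀ a : A, ‖a - a * u‖ ≤ ‖a‖) ∧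
      ∀ x ∈ I, Tendsto (fun u ↦ x * u) l (𝓝 x) := by
  have : IsClosed (hI.starPart : Set A) :=
    hI.2.1.inter (hI.2.1.preimage continuous_star)
  let _ := CStarAlgebra.spectralOrder A
  have := CStarAlgebra.spectralOrderedRing A
  let _ := CStarAlgebra.spectralOrder hI.starPart
  have := CStarAlgebra.spectralOrderedRing hI.starPart
  have hl := CStarAlgebra.increasingApproximateUnit hI.starPart
  have hne := hl.neBot
  have hev : ∀ᶠ u : A in (CStarAlgebra.approximateUnit hI.starPart).map Subtype.val,
      u ∈ I ∧ star u = u ∧ ∀ a : A, ‖a - a * u‖ ≤ ‖a‖ := by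
    rw [eventually_map]
    filter_upwards [hl.eventually_nonneg, hl.eventually_norm] with u hu hu1
    have hu0 : (0 : A) ≤ u := by
      obtain ⟨v, rfl⟩ := CStarAlgebra.nonneg_iff_eq_star_mul_self.mp hu
      exact star_mul_self_nonneg (v : A)
    exact ⟨u.2.1, hu0.star_eq, norm_sub_mul_le_of_nonneg hu0 hu1⟩
  refine ⟨_, hne.map Subtype.val, hev, fun x hx ↦ ?_⟩
  have hb : star x * x ∈ hI.starPart := by
    have h := (hI.2.2.2.2.2 x hx (star x) trivial).1
    exact ⟨h, by simpa using h⟩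
  have hlim : Tendsto (fun u : A ↦ star x * x * u)
      ((CStarAlgebra.approximateUnit hI.starPart).map Subtype.val) (𝓝 (star x * x)) := by
    rw [tendsto_map'_iff]
    exact (continuous_subtype_val.tendsto _).comp (hl.tendsto_mul_left ⟨star x * x, hb⟩)
  have hlim' : Tendsto (fun u : A ↦ √‖star x * x - star x * x * u‖)
      ((CStarAlgebra.approximateUnit hI.starPart).map Subtype.val) (𝓝 0) := by
    simpa only [sub_self, norm_zero, Real.sqrt_zero] using
      ((tendsto_const_nhds (x := star x * x)).sub hlim).norm.sqrt
  rw [tendsto_iff_norm_sub_tendsto_zero]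
  refine squeeze_zero' (.of_forall fun u ↦ norm_nonneg _) ?_ hlim'
  filter_upwards [hev] with u hu
  rw [norm_sub_rev]
  exact Real.le_sqrt_of_sq_le ((sq _).trans_le (norm_sub_mul_sq_le hu.2.1 hu.2.2 x))

lemma IsIdealOf.star_mem (hI : IsIdealOf I Set.univ) {x : A} (hx : x ∈ I) : star x ∈ I := by
  obtain ⟨l, hne, hev, hlim⟩ := hI.exists_approximateUnit
  refine hI.2.1.mem_of_tendsto ((continuous_star.tendsto _).comp (hlim x hx)) ?_
  filter_upwards [hev] with u hu
  simp only [Function.comp_apply, star_mul, hu.2.1]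
  exact (hI.2.2.2.2.2 u hu.1 _ trivial).2

/-- A closed ideal of a C⋆-algebra as a complex subspace. -/
def IsIdealOf.toSubmodule (hI : IsIdealOf I Set.univ) : Submodule ℂ A where
  carrier := I
  add_mem' hx hy := hI.2.2.2.1 _ hx _ hy
  zero_mem' := hI.2.2.1
  smul_mem' c _ hx := hI.smul_mem c hx

lemma IsIdealOf.norm_mk_mul_self_le (hI : IsIdealOf I Set.univ) (a : A) :
    ‖hI.toSubmodule.mkQ a‖ * ‖hI.toSubmodule.mkQ a‖ ≤ ‖hI.toSubmodule.mkQ (star a * a)‖ := by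
  obtain ⟨l, hne, hev, hlim⟩ := hI.exists_approximateUnit
  refine le_of_forall_pos_lt_add fun ε hε ↦ ?_
  obtain ⟨m, hm, hmlt⟩ :=
    Submodule.Quotient.norm_mk_lt (hI.toSubmodule.mkQ (star a * a)) hε
  refine lt_of_le_of_lt ?_ hmlt
  have hy : star a * a - m ∈ I := (Submodule.Quotient.eq hI.toSubmodule).mp hm.symm
  set y := star a * a - m with hydef
  have hlim' : Tendsto (fun u ↦ ‖m‖ + ‖y - y * u‖) l (𝓝 ‖m‖) := by
    simpa using (tendsto_const_nhds (x := ‖m‖)).add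
      ((tendsto_const_nhds (x := y)).sub (hlim y hy)).norm
  refine ge_of_tendsto hlim' ?_
  filter_upwards [hev] with u ⟨huI, hus, huc⟩
  have hmk : hI.toSubmodule.mkQ a = hI.toSubmodule.mkQ (a - a * u) := by
    refine (Submodule.Quotient.eq hI.toSubmodule).mpr ?_
    rw [sub_sub_cancel]
    exact (hI.2.2.2.2.2 u huI a trivial).1
  have hle : ‖hI.toSubmodule.mkQ a‖ ≤ ‖a - a * u‖ := by
    rw [hmk]; exact Submodule.Quotient.norm_mk_le hI.toSubmodule (a - a * u)
  calc ‖hI.toSubmodule.mkQ a‖ * ‖hI.toSubmodule.mkQ a‖ ≤ ‖a - a * u‖ * ‖a - a * u‖ := by gcongr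
    _ ≤ ‖star a * a - star a * a * u‖ := norm_sub_mul_sq_le hus huc a
    _ = ‖(m - m * u) + (y - y * u)‖ := by
      congr 1
      rw [hydef]
      noncomm_ring
    _ ≤ ‖m - m * u‖ + ‖y - y * u‖ := norm_add_le _ _
    _ ≤ ‖m‖ + ‖y - y * u‖ := by gcongr; exact huc m

/-- The quotient of a C⋆-algebra by a closed ideal. -/
abbrev IsIdealOf.Quot (hI : IsIdealOf I Set.univ) : Type _ := A ⧸ hI.toSubmodule

noncomputable instance (hI : IsIdealOf I Set.univ) : NormedAddCommGroup hI.Quot :=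
  haveI : IsClosed (hI.toSubmodule : Set A) := hI.2.1
  Submodule.Quotient.normedAddCommGroup hI.toSubmodule

instance (hI : IsIdealOf I Set.univ) : Mul hI.Quot where
  mul := Quotient.map₂ (· * ·) fun a b hab c d hcd ↦ by
    refine (Submodule.quotientRel_def hI.toSubmodule).mpr ?_
    replace hab := (Submodule.quotientRel_def hI.toSubmodule).mp hab
    replace hcd := (Submodule.quotientRel_def hI.toSubmodule).mp hcd
    have h : a * c - b * d = (a - b) * c + b * (c - d) := by noncomm_ring
    rw [h]
    exact hI.2.2.2.1 _ (hI.2.2.2.2.2 _ hab _ trivial).2 _ (hI.2.2.2.2.2 _ hcd _ trivial).1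

instance (hI : IsIdealOf I Set.univ) : Star hI.Quot where
  star := Quotient.map star fun a b hab ↦ by
    refine (Submodule.quotientRel_def hI.toSubmodule).mpr ?_
    replace hab := (Submodule.quotientRel_def hI.toSubmodule).mp hab
    rw [← star_sub]
    exact hI.star_mem hab

lemma IsIdealOf.norm_quot_mul_le (hI : IsIdealOf I Set.univ) (x y : hI.Quot) :
    ‖x * y‖ ≤ ‖x‖ * ‖y‖ := by
  have hlim : Tendsto (fun ε : ℝ ↦ (‖x‖ + ε) * (‖y‖ + ε)) (𝓝[>] 0) (𝓝 (‖x‖ * ‖y‖)) := by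
    have h : Continuous fun ε : ℝ ↦ (‖x‖ + ε) * (‖y‖ + ε) := by fun_prop
    simpa using (h.tendsto 0).mono_left nhdsWithin_le_nhds
  refine ge_of_tendsto hlim ?_
  filter_upwards [self_mem_nhdsWithin] with ε hε
  obtain ⟨a, rfl, ha⟩ := Submodule.Quotient.norm_mk_lt x hε
  obtain ⟨b, rfl, hb⟩ := Submodule.Quotient.norm_mk_lt y hε
  calc ‖hI.toSubmodule.mkQ (a * b)‖ ≤ ‖a * b‖ :=
        Submodule.Quotient.norm_mk_le hI.toSubmodule (a * b)
    _ ≤ ‖a‖ * ‖b‖ := norm_mul_le a b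
    _ ≤ _ := mul_le_mul ha.le hb.le (norm_nonneg b) ((norm_nonneg a).trans ha.le)

noncomputable instance (hI : IsIdealOf I Set.univ) : NonUnitalCStarAlgebra hI.Quot where
  __ := (inferInstance : NormedAddCommGroup hI.Quot)
  __ := (inferInstance : Module ℂ hI.Quot)
  left_distrib := by
    rintro ⟨a⟩ ⟨b⟩ ⟨c⟩
    exact congrArg hI.toSubmodule.mkQ (mul_add a b c)
  right_distrib := by
    rintro ⟨a⟩ ⟨b⟩ ⟨c⟩
    exact congrArg hI.toSubmodule.mkQ (add_mul a b c)
  zero_mul := by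
    rintro ⟨a⟩
    exact congrArg hI.toSubmodule.mkQ (zero_mul a)
  mul_zero := by
    rintro ⟨a⟩
    exact congrArg hI.toSubmodule.mkQ (mul_zero a)
  mul_assoc := by
    rintro ⟨a⟩ ⟨b⟩ ⟨c⟩
    exact congrArg hI.toSubmodule.mkQ (mul_assoc a b c)
  norm_mul_le := hI.norm_quot_mul_le
  star_involutive := by
    rintro ⟨a⟩
    exact congrArg hI.toSubmodule.mkQ (star_star a)
  star_mul := by
    rintro ⟨a⟩ ⟨b⟩
    exact congrArg hI.toSubmodule.mkQ (star_mul a b)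
  star_add := by
    rintro ⟨a⟩ ⟨b⟩
    exact congrArg hI.toSubmodule.mkQ (star_add a b)
  complete := (inferInstance : CompleteSpace (A ⧸ hI.toSubmodule)).complete
  norm_mul_self_le := by
    rintro ⟨a⟩
    exact hI.norm_mk_mul_self_le a
  norm_smul_le := norm_smul_le (α := ℂ) (β := A ⧸ hI.toSubmodule)
  smul_assoc := by
    rintro c ⟨a⟩ ⟨b⟩
    exact congrArg hI.toSubmodule.mkQ (smul_mul_assoc c a b)
  smul_comm := by
    rintro c ⟨a⟩ ⟨b⟩
    exact congrArg hI.toSubmodule.mkQ (mul_smul_comm c a b).symm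
  star_smul := by
    rintro c ⟨a⟩
    exact congrArg hI.toSubmodule.mkQ (star_smul c a)

/-- The quotient map of a C⋆-algebra by a closed ideal, as a ⋆-homomorphism. -/
def IsIdealOf.mk (hI : IsIdealOf I Set.univ) : A →⋆ₙₐ[ℂ] hI.Quot where
  toFun := hI.toSubmodule.mkQ
  map_smul' c a := map_smul hI.toSubmodule.mkQ c a
  map_zero' := rfl
  map_add' _ _ := rfl
  map_mul' _ _ := rfl
  map_star' _ := rfl

lemma IsIdealOf.mk_surjective (hI : IsIdealOf I Set.univ) : Function.Surjective hI.mk :=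
  hI.toSubmodule.mkQ_surjective

lemma IsIdealOf.mk_eq_iff (hI : IsIdealOf I Set.univ) {a b : A} :
    hI.mk a = hI.mk b ↔ a - b ∈ I :=
  Submodule.Quotient.eq hI.toSubmodule

end Ideal

lemma isIdealOf_genIdealOf {R : Type*} [NonUnitalRing R] [TopologicalSpace R] (X : Set R) :
    IsIdealOf (genIdealOf Set.univ X) (Set.univ : Set R) :=
  ⟨Set.subset_univ _, isClosed_sInter fun _ hJ ↦ hJ.1.2.1, fun _ hJ ↦ hJ.1.2.2.1,
    fun x hx y hy J hJ ↦ hJ.1.2.2.2.1 x (hx J hJ) y (hy J hJ),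
    fun x hx J hJ ↦ hJ.1.2.2.2.2.1 x (hx J hJ),
    fun x hx a ha ↦ ⟨fun J hJ ↦ (hJ.1.2.2.2.2.2 x (hx J hJ) a ha).1,
      fun J hJ ↦ (hJ.1.2.2.2.2.2 x (hx J hJ) a ha).2⟩⟩

lemma isIdealOf_ker {A B : Type*} [NonUnitalCStarAlgebra A] [NonUnitalCStarAlgebra B]
    (φ : A →⋆ₙₐ[ℂ] B) : IsIdealOf {a | φ a = 0} Set.univ :=
  ⟨Set.subset_univ _, isClosed_eq (map_continuous φ) continuous_const, map_zero φ,
    fun x hx y hy ↦ by simp_all, fun x hx ↦ by simp_all, fun x hx a _ ↦ by simp_all⟩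

end CQP

/-- **Proposition 3.1.** For a C*-algebra `A` the following are equivalent:
(i) `A` has the CQ-property;
(ii) for every surjective *-homomorphism `φ : A → B` onto a C*-algebra `B`,
`φ(Z(A)) = Z(B)`;
(iii) for every `a ∈ A`, `a ∈ Z(A) + Id_A([a,A])`. -/
theorem stmt0 {A : Type u} [NonUnitalCStarAlgebra A] :
    (HasCQ (Set.univ : Set A) ↔
      (∀ (B : Type u) (_ : NonUnitalCStarAlgebra B) (φ : A →⋆ₙₐ[ℂ] B),
        Function.Surjective φ →
          φ '' centerOf (Set.univ : Set A) = centerOf (Set.univ : Set B))) ∧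
    (HasCQ (Set.univ : Set A) ↔
      (∀ a : A, ∃ z ∈ centerOf (Set.univ : Set A),
        ∃ j ∈ genIdealOf (Set.univ : Set A) {y | ∃ x : A, y = a * x - x * a},
          a = z + j)) := by
  refine ⟨⟨fun h B _ φ hφ ↦ ?_, fun h I hI a _ ha ↦ ?_⟩, fun h a ↦ ?_, fun h I hI a _ ha ↦ ?_⟩
  · refine Set.Subset.antisymm ?_ fun b hb ↦ ?_
    · rintro _ ⟨z, hz, rfl⟩
      refine ⟨trivial, fun y _ ↦ ?_⟩
      obtain ⟨x, rfl⟩ := hφ y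
      rw [← map_mul, ← map_mul, hz.2 x trivial]
    · obtain ⟨a, rfl⟩ := hφ b
      obtain ⟨z, hz, hza⟩ := h _ (isIdealOf_ker φ) a trivial fun x _ ↦ by
        simpa [sub_eq_zero] using hb.2 (φ x) trivial
      refine ⟨z, hz, ?_⟩
      exact (sub_eq_zero.mp ((map_sub φ a z).symm.trans hza)).symm
  · have hc : hI.mk a ∈ centerOf (Set.univ : Set hI.Quot) := by
      refine ⟨trivial, fun y _ ↦ ?_⟩
      obtain ⟨x, rfl⟩ := hI.mk_surjective y
      rw [← map_mul, ← map_mul, hI.mk_eq_iff]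
      exact ha x trivial
    rw [← h hI.Quot inferInstance hI.mk hI.mk_surjective] at hc
    obtain ⟨z, hz, hza⟩ := hc
    exact ⟨z, hz, hI.mk_eq_iff.mp hza.symm⟩
  · obtain ⟨z, hz, hza⟩ := h _ (isIdealOf_genIdealOf {y | ∃ x : A, y = a * x - x * a}) a trivial
      fun x _ J hJ ↦ hJ.2 ⟨x, rfl⟩
    exact ⟨z, hz, a - z, hza, (add_sub_cancel z a).symm⟩
  · obtain ⟨z, hz, j, hj, rfl⟩ := h a
    refine ⟨z, hz, ?_⟩
    rw [add_sub_cancel_left]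
    refine hj I ⟨hI, ?_⟩
    rintro _ ⟨x, rfl⟩
    exact ha x trivial
end

section
/- If a C*-algebra A has the centre-quotient (CQ) property, then every ideal of A and every quotient of A by an ideal also has the CQ-property. -/
open Filter Topology Pointwise

open CQP

/-- Every element of a C*-algebra is topologically von Neumann regular. -/
lemma mem_closure_range_mul_mul_self {A : Type*} [NonUnitalCStarAlgebra A] (x : A) :
    x ∈ closure (Set.range fun w : A => x * w * x) := by
  let _ : PartialOrder A := CStarAlgebra.spectralOrder A
  have _ : StarOrderedRing A := CStarAlgebra.spectralOrderedRing A
  rw [Metric.mem_closure_iff]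
  intro ε hε
  set b : A := x * star x with hb
  have hbsa : IsSelfAdjoint b := IsSelfAdjoint.mul_star_self x
  have hb0 : 0 ≤ b := mul_star_self_nonneg x
  set d : ℝ := ε ^ 4 with hd
  have hdpos : 0 < d := by positivity
  let h : ℝ → ℝ := fun t => t / (t ^ 2 + d)
  have hden : ∀ t : ℝ, t ^ 2 + d ≠ 0 := fun t => by positivity
  have hcont : Continuous h := continuous_id.div (by fun_prop) hden
  have h_zero : h 0 = 0 := by simp [h]
  set c : A := cfcₙ h b with hc
  have hcsa : star c = c := (cfcₙ_predicate h b : IsSelfAdjoint c)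
  refine ⟨_, ⟨star x * c, rfl⟩, ?_⟩
  have hexp : (x - x * (star x * c) * x) * star (x - x * (star x * c) * x)
      = cfcₙ (fun t => t - t * h t * t - t * (h t * t) + t * h t * t * (h t * t)) b := by
    have hid : cfcₙ (fun t : ℝ => t) b = b := cfcₙ_id' ℝ b
    have hcc : ContinuousOn h (quasispectrum ℝ b) := hcont.continuousOn
    have k1 : Continuous fun t => t * h t := by fun_prop
    have k2 : Continuous fun t => h t * t := by fun_prop
    have k3 : Continuous fun t => t * h t * t := by fun_prop
    have k4 : Continuous fun t => t * (h t * t) := by fun_prop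
    have e1 : cfcₙ (fun t => t * h t) b = b * c := by
      rw [cfcₙ_mul (fun t => t) h b continuousOn_id rfl hcc h_zero, hid]
    have e2 : cfcₙ (fun t => h t * t) b = c * b := by
      rw [cfcₙ_mul h (fun t => t) b hcc h_zero continuousOn_id rfl, hid]
    have e3 : cfcₙ (fun t => t * h t * t) b = b * c * b := by
      rw [cfcₙ_mul (fun t => t * h t) (fun t => t) b k1.continuousOn (zero_mul _)
        continuousOn_id rfl, hid, e1]
    have e4 : cfcₙ (fun t => t * (h t * t)) b = b * (c * b) := by
      rw [cfcₙ_mul (fun t => t) (fun t => h t * t) b continuousOn_id rfl k2.continuousOn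
        (mul_zero _), hid, e2]
    have e5 : cfcₙ (fun t => t * h t * t * (h t * t)) b = b * c * b * (c * b) := by
      rw [cfcₙ_mul (fun t => t * h t * t) (fun t => h t * t) b k3.continuousOn (mul_zero _)
        k2.continuousOn (mul_zero _), e3, e2]
    rw [cfcₙ_add (fun t => t - t * h t * t - t * (h t * t))
        (fun t => t * h t * t * (h t * t)) b
        ((continuous_id.sub k3).sub k4).continuousOn (by simp) (k3.mul k2).continuousOn (by simp),
      cfcₙ_sub (fun t => t - t * h t * t) (fun t => t * (h t * t)) b
        (continuous_id.sub k3).continuousOn (by simp) k4.continuousOn (by simp),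
      cfcₙ_sub (fun t => t) (fun t => t * h t * t) b
        continuousOn_id rfl k3.continuousOn (by simp), hid, e3, e4, e5]
    simp only [star_sub, star_mul, star_star, hcsa, hb]
    noncomm_ring
  have hbound : ‖(x - x * (star x * c) * x) * star (x - x * (star x * c) * x)‖ ≤ ε ^ 2 / 2 := by
    rw [hexp]
    refine norm_cfcₙ_le fun t ht => ?_
    have ht0 : 0 ≤ t := quasispectrum_nonneg_of_nonneg b hb0 t ht
    have key : t - t * h t * t - t * (h t * t) + t * h t * t * (h t * t)
        = t * (d / (t ^ 2 + d)) ^ 2 := by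
      simp only [h]; field_simp [hden t]; ring
    rw [key, Real.norm_of_nonneg (by positivity)]
    have h1 : d / (t ^ 2 + d) ≤ 1 := by
      rw [div_le_one (by positivity)]; nlinarith [sq_nonneg t]
    have h2 : t * (d / (t ^ 2 + d)) ≤ ε ^ 2 / 2 := by
      rw [← mul_div_assoc, div_le_iff₀ (by positivity), hd]
      nlinarith [mul_nonneg (sq_nonneg ε) (sq_nonneg (t - ε ^ 2))]
    calc t * (d / (t ^ 2 + d)) ^ 2 = t * (d / (t ^ 2 + d)) * (d / (t ^ 2 + d)) := by ring
      _ ≤ t * (d / (t ^ 2 + d)) * 1 := by gcongr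
      _ ≤ ε ^ 2 / 2 := by rw [mul_one]; exact h2
  rw [CStarRing.norm_self_mul_star] at hbound
  rw [dist_eq_norm]
  nlinarith [norm_nonneg (x - x * (star x * c) * x)]

/-- A continuous map sends `x` into a closed set as soon as it sends all `x * w * x` into it. -/
lemma mem_of_forall_mul_mul_self {A : Type*} [NonUnitalCStarAlgebra A] {K : Set A}
    (hK : IsClosed K) {f : A → A} (hf : Continuous f) {x : A}
    (hx : ∀ w, f (x * w * x) ∈ K) : f x ∈ K :=
  closure_minimal (by rintro _ ⟨w, rfl⟩; exact hx w) (hK.preimage hf)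
    (mem_closure_range_mul_mul_self x)

/-- A closed ideal of a closed ideal of a C*-algebra is an ideal of the whole algebra. -/
lemma CQP.IsIdealOf.trans_univ {A : Type*} [NonUnitalCStarAlgebra A] {K I : Set A}
    (hK : IsIdealOf K I) (hI : IsIdealOf I Set.univ) : IsIdealOf K Set.univ := by
  obtain ⟨hKI, hcl, h0, hadd, hneg, hmul⟩ := hK
  obtain ⟨-, -, -, -, -, hImul⟩ := hI
  refine ⟨Set.subset_univ _, hcl, h0, hadd, hneg, fun k hk b _ => ⟨?_, ?_⟩⟩
  · refine mem_of_forall_mul_mul_self hcl (f := fun y => b * y) (by fun_prop) fun w => ?_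
    have hbkw : b * k * w ∈ I :=
      (hImul _ (hImul k (hKI hk) b trivial).1 w trivial).2
    simpa only [mul_assoc] using (hmul k hk _ hbkw).1
  · refine mem_of_forall_mul_mul_self hcl (f := fun y => y * b) (by fun_prop) fun w => ?_
    have hwkb : w * k * b ∈ I :=
      (hImul _ (hImul k (hKI hk) w trivial).1 b trivial).2
    simpa only [mul_assoc] using (hmul k hk _ hwkb).2

/-- An element of an ideal `I` that commutes with `I` modulo `K` commutes with the whole
algebra modulo `K`. -/
lemma commutator_mem_of_forall_mem_ideal {A : Type*} [NonUnitalCStarAlgebra A] {K I : Set A}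
    (hK : IsIdealOf K Set.univ) (hI : IsIdealOf I Set.univ) {a : A} (ha : a ∈ I)
    (hcomm : ∀ x ∈ I, a * x - x * a ∈ K) (b : A) : a * b - b * a ∈ K := by
  obtain ⟨-, hcl, -, hadd, hneg, hmul⟩ := hK
  obtain ⟨-, -, -, hIadd, hIneg, hImul⟩ := hI
  have hcI : a * b - b * a ∈ I := by
    rw [sub_eq_add_neg]
    exact hIadd _ (hImul a ha b trivial).2 _ (hIneg _ (hImul a ha b trivial).1)
  have hcy : ∀ y ∈ I, (a * b - b * a) * y ∈ K := fun y hy => by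
    have h1 := hcomm (b * y) (hImul y hy b trivial).1
    have h2 := hneg _ (hmul _ (hcomm y hy) b trivial).1
    convert hadd _ h1 _ h2 using 1
    noncomm_ring
  refine mem_of_forall_mul_mul_self hcl (f := fun y => y) continuous_id fun w => ?_
  simpa only [mul_assoc] using hcy _ (hImul _ hcI w trivial).1

/-- **Proposition 3.2.** If a C*-algebra `A` has the CQ-property, then so does every
(closed two-sided) ideal of `A` and every quotient of `A` by an ideal. -/
theorem stmt1 {A : Type*} [NonUnitalCStarAlgebra A]
    (h : HasCQ (Set.univ : Set A)) :
    ∀ I : Set A, IsIdealOf I (Set.univ : Set A) → HasCQ I ∧ HasCQmod I := by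
  intro I hI
  constructor
  · intro K hK a ha hcomm
    have hKA := hK.trans_univ hI
    obtain ⟨z, ⟨-, hz⟩, haz⟩ := h K hKA a trivial fun x _ =>
      commutator_mem_of_forall_mem_ideal hKA hI ha hcomm x
    have hzI : z ∈ I := by
      have := hI.2.2.2.1 _ (hI.2.2.2.2.1 _ (hK.1 haz)) _ ha
      simpa using this
    exact ⟨z, ⟨hzI, fun x _ => hz x trivial⟩, haz⟩
  · intro K hK _ a hcomm
    obtain ⟨z, ⟨-, hz⟩, haz⟩ := h K hK a trivial fun x _ => hcomm x
    refine ⟨z, fun x => ?_, haz⟩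
    rw [hz x trivial, sub_self]
    exact hI.2.2.1
end

section
/- Let A be a non-unital C*-algebra and let A♯ denote its minimal unitization. Then A has the centre-quotient (CQ) property if and only if A♯ has the CQ-property. -/
open Filter Topology Pointwise

open CQP

theorem unitization_fst_sub {S B : Type*} [AddGroup S] [AddGroup B] (x y : Unitization S B) :
    (x - y).fst = x.fst - y.fst := rfl

theorem unitization_snd_sub {S B : Type*} [AddGroup S] [AddGroup B] (x y : Unitization S B) :
    (x - y).snd = x.snd - y.snd := rfl

theorem smul_mem_of_isIdealOf {A : Type*} [NonUnitalCStarAlgebra A] {I : Set A}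
    (hI : IsIdealOf I Set.univ) (c : ℂ) {x : A} (hx : x ∈ I) : c • x ∈ I := by
  obtain ⟨-, hcl, -, -, -, hmul⟩ := hI
  let : PartialOrder A := CStarAlgebra.spectralOrder A
  have : StarOrderedRing A := CStarAlgebra.spectralOrderedRing A
  have hau := CStarAlgebra.increasingApproximateUnit A
  have := hau.toIsApproximateUnit.neBot
  have h1 := (hau.toIsApproximateUnit.tendsto_mul_right x).const_smul c
  refine hcl.mem_of_tendsto h1 (Eventually.of_forall fun e => ?_)
  simpa only [id, smul_mul_assoc] using (hmul x hx (c • e) trivial).1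

theorem isIdealOf_inr_preimage {A : Type*} [NonUnitalCStarAlgebra A]
    {J : Set (Unitization ℂ A)} (hJ : IsIdealOf J Set.univ) :
    IsIdealOf ((fun x : A => (x : Unitization ℂ A)) ⁻¹' J) Set.univ := by
  obtain ⟨-, hcl, h0, hadd, hneg, hmul⟩ := hJ
  refine ⟨Set.subset_univ _, hcl.preimage Unitization.continuous_inr, ?_, ?_, ?_, ?_⟩
  · simpa using h0
  · intro x hx y hy
    simpa using hadd _ hx _ hy
  · intro x hx
    simpa using hneg _ hx
  · intro x hx a _
    simpa using hmul _ hx a trivial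

theorem isIdealOf_inr_image {A : Type*} [NonUnitalCStarAlgebra A]
    {I : Set A} (hI : IsIdealOf I Set.univ) :
    IsIdealOf ((fun x : A => (x : Unitization ℂ A)) '' I) Set.univ := by
  have hsmul := fun (c : ℂ) {x : A} (hx : x ∈ I) => smul_mem_of_isIdealOf hI c hx
  obtain ⟨-, hcl, h0, hadd, hneg, hmul⟩ := hI
  refine ⟨Set.subset_univ _, ?_, ⟨0, h0, Unitization.inr_zero ℂ⟩, ?_, ?_, ?_⟩
  · exact (Unitization.isometry_inr (𝕜 := ℂ) (A := A)).isClosedEmbedding.isClosedMap I hcl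
  · rintro _ ⟨x, hx, rfl⟩ _ ⟨y, hy, rfl⟩
    exact ⟨x + y, hadd x hx y hy, Unitization.inr_add ℂ x y⟩
  · rintro _ ⟨x, hx, rfl⟩
    exact ⟨-x, hneg x hx, Unitization.inr_neg ℂ x⟩
  · rintro _ ⟨x, hx, rfl⟩ a -
    refine ⟨⟨a.fst • x + a.snd * x, hadd _ (hsmul _ hx) _ (hmul x hx _ trivial).1, ?_⟩,
      ⟨a.fst • x + x * a.snd, hadd _ (hsmul _ hx) _ (hmul x hx _ trivial).2, ?_⟩⟩ <;>
    ext <;> simp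

/-- **Proposition 3.4.** A non-unital C*-algebra `A` has the CQ-property if and only if
its minimal unitization `A♯ = Unitization ℂ A` has the CQ-property. -/
theorem stmt2 {A : Type*} [NonUnitalCStarAlgebra A]
    (hnu : ¬ ∃ e : A, ∀ x : A, e * x = x ∧ x * e = x) :
    HasCQ (Set.univ : Set A) ↔ HasCQ (Set.univ : Set (Unitization ℂ A)) := by
  constructor
  · intro h J hJ b _ hb
    have hI := isIdealOf_inr_preimage hJ
    obtain ⟨z, ⟨-, hz⟩, hbz⟩ := h _ hI b.snd trivial fun x _ => by
      have hx : ((b.snd * x - x * b.snd : A) : Unitization ℂ A) = b * x - x * b := by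
        ext <;> simp [unitization_fst_sub, unitization_snd_sub, mul_comm]
      simpa only [Set.mem_preimage, hx] using hb x trivial
    refine ⟨Unitization.inl b.fst + (z : Unitization ℂ A), ⟨trivial, fun x _ => ?_⟩, ?_⟩
    · ext
      · simp [mul_comm]
      · simp [hz x.snd trivial]
        abel
    · have hx : b - (Unitization.inl b.fst + (z : Unitization ℂ A)) = ((b.snd - z : A) : Unitization ℂ A) := by
        ext <;> simp [unitization_fst_sub, unitization_snd_sub]
      rw [hx]
      exact hbz
  · intro h I hI a _ ha
    obtain ⟨z, ⟨-, hz⟩, c, hc, hcz⟩ := h _ (isIdealOf_inr_image hI) a trivial fun x _ =>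
      ⟨a * x.snd - x.snd * a, ha _ trivial, by ext <;> simp [unitization_fst_sub, unitization_snd_sub, mul_comm]⟩
    have hfst : z.fst = 0 := by
      simpa [unitization_fst_sub] using (congrArg (fun y : Unitization ℂ A => y.fst) hcz).symm
    have hsnd : c = a - z.snd := by
      simpa [unitization_snd_sub] using congrArg (fun y : Unitization ℂ A => y.snd) hcz
    refine ⟨z.snd, ⟨trivial, fun x _ => ?_⟩, hsnd ▸ hc⟩
    simpa [hfst] using congrArg (fun y : Unitization ℂ A => y.snd) (hz x trivial)
end

section
/- A C*-algebra A (not necessarily unital) has the centre-quotient (CQ) property if and only if A is weakly central. -/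
open Filter Topology Pointwise

open CQP

theorem exists_approx {U : Type*} [CStarAlgebra U] (x : U) {ε : ℝ} (hε : 0 < ε) :
    ∃ u : U, IsSelfAdjoint (u * (star x * x)) ∧ ‖1 - u * (star x * x)‖ ≤ 1 ∧
      ‖x - x * (u * (star x * x))‖ ≤ ε := by
  obtain ⟨n, hn0, hn⟩ : ∃ n : ℝ, 0 < n ∧ 2 / n ≤ ε ^ 2 :=
    ⟨2 / ε ^ 2, by positivity, by rw [div_div_cancel₀ (by norm_num)]⟩
  set h : U := star x * x with hh
  have hsa : IsSelfAdjoint h := IsSelfAdjoint.star_mul_self x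
  have hspec : ∀ t ∈ spectrum ℝ h, 0 ≤ t := fun t ht => spectrum_star_mul_self_nonneg t ht
  set w : U := cfc (fun t : ℝ => (1 + n * t)⁻¹) h with hw
  have hne : ∀ t ∈ spectrum ℝ h, 1 + n * t ≠ 0 := fun t ht => by
    have := hspec t ht; positivity
  have hcont : ContinuousOn (fun t : ℝ => (1 + n * t)⁻¹) (spectrum ℝ h) :=
    ContinuousOn.inv₀ (by fun_prop) hne
  have hwsa : IsSelfAdjoint w := cfc_predicate _ _
  have hw1 : ‖w‖ ≤ 1 := by
    refine norm_cfc_le zero_le_one fun t ht => ?_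
    have := hspec t ht
    rw [Real.norm_of_nonneg (by positivity)]
    exact inv_le_one_of_one_le₀ (by nlinarith)
  have hmul : w * (1 + n • h) = 1 := by
    have h1 : (1 + n • h : U) = cfc (fun t : ℝ => 1 + n * t) h := by
      rw [cfc_const_add (1 : ℝ) (fun t : ℝ => n * t) h, cfc_const_mul_id n h, map_one]
    rw [h1, hw, ← cfc_mul _ _ h hcont, ← cfc_one ℝ h]
    exact cfc_congr fun t ht => inv_mul_cancel₀ (hne t ht)
  have he : (n • w) * h = 1 - w := by
    rw [eq_sub_iff_add_eq, ← hmul]; simp [mul_add, add_comm]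
  refine ⟨n • w, ?_, ?_, ?_⟩
  · rw [he]; exact (IsSelfAdjoint.one U).sub hwsa
  · rw [he]; simpa using hw1
  · rw [he]
    have e1 : x - x * (1 - w) = x * w := by noncomm_ring
    rw [e1]
    have e2 : star (x * w) * (x * w) = n⁻¹ • ((1 - w) * w) := by
      rw [← he, star_mul, hwsa.star_eq]
      simp [smul_smul, hn0.ne', hh, mul_assoc]
    have e3 : ‖x * w‖ * ‖x * w‖ ≤ ε * ε := by
      rw [← CStarRing.norm_star_mul_self, e2, norm_smul, Real.norm_of_nonneg (by positivity)]
      have : ‖(1 - w) * w‖ ≤ 2 := by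
        have : (1 - w) * w = w - w * w := by noncomm_ring
        rw [this]
        refine (norm_sub_le _ _).trans ?_
        have := (norm_mul_le w w).trans (mul_le_one₀ hw1 (norm_nonneg _) hw1)
        linarith
      calc n⁻¹ * ‖(1 - w) * w‖ ≤ n⁻¹ * 2 := by gcongr
        _ ≤ _ := by rw [← sq]; convert hn using 1; field_simp
    exact abs_le_of_sq_le_sq' (by nlinarith) hε.le |>.2

theorem exists_lift_selfAdjoint {E B : Type*} [CStarAlgebra E] [CStarAlgebra B] (ψ : E →⋆ₐ[ℂ] B)
    {z : E} (hz : IsSelfAdjoint z) : ∃ z', ψ z' = ψ z ∧ ‖z'‖ ≤ ‖ψ z‖ := by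
  set r := ‖ψ z‖
  have hr : 0 ≤ r := norm_nonneg _
  have hd : IsSelfAdjoint (ψ z) := hz.map ψ
  have hcont : Continuous (ψ : E → B) :=
    AddMonoidHomClass.continuous_of_bound ψ 1
      (fun x => by simpa using NonUnitalStarAlgHom.norm_apply_le ψ x)
  refine ⟨cfc (fun t : ℝ => max (-r) (min r t)) z, ?_, ?_⟩
  · rw [StarAlgHomClass.map_cfc ψ (fun t : ℝ => max (-r) (min r t)) z]
    conv_rhs => rw [← cfc_id ℝ (ψ z)]
    refine cfc_congr fun t ht => ?_
    have h1 := norm_apply_le_norm_cfc (id : ℝ → ℝ) (ψ z) ht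
    rw [cfc_id ℝ (ψ z), id, Real.norm_eq_abs, abs_le] at h1
    change max (-r) (min r t) = t
    rw [min_eq_right h1.2, max_eq_right h1.1]
  · refine norm_cfc_le hr fun t _ => ?_
    rw [Real.norm_eq_abs, abs_le]
    exact ⟨le_max_left _ _, max_le (by linarith) (min_le_left _ _)⟩

theorem isClosed_range_starAlgHom {E B : Type*} [CStarAlgebra E] [CStarAlgebra B]
    (ψ : E →⋆ₐ[ℂ] B) : IsClosed (Set.range ψ) := by
  let f : NormedAddGroupHom E B :=
    AddMonoidHom.mkNormedAddGroupHom (ψ : E →+ B) 1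
      (fun x => by simpa using NonUnitalStarAlgHom.norm_apply_le ψ x)
  have key : f.SurjectiveOnWith f.range 2 := by
    rintro _ ⟨z, rfl⟩
    have hR : ‖ψ (realPart z : E)‖ ≤ ‖ψ z‖ := by
      rw [map_realPart]
      exact realPart.norm_le (ψ z)
    have hI : ‖ψ (imaginaryPart z : E)‖ ≤ ‖ψ z‖ := by
      rw [map_imaginaryPart]
      exact imaginaryPart.norm_le (ψ z)
    obtain ⟨a, ha, ha'⟩ := exists_lift_selfAdjoint ψ (realPart z).2
    obtain ⟨b, hb, hb'⟩ := exists_lift_selfAdjoint ψ (imaginaryPart z).2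
    refine ⟨a + Complex.I • b, ?_, ?_⟩
    · change ψ _ = ψ z
      rw [map_add, map_smul, ha, hb, ← map_smul, ← map_add, realPart_add_I_smul_imaginaryPart]
    · change _ ≤ 2 * ‖ψ z‖
      refine (norm_add_le _ _).trans ?_
      rw [norm_smul, Complex.norm_I, one_mul]
      linarith
  have h2 := controlled_closure_of_complete two_pos one_pos key
  refine isClosed_of_closure_subset fun y hy => ?_
  obtain ⟨g, hg, _⟩ := h2 y hy
  exact ⟨g, hg⟩


theorem star_mem_of_isClosed {U : Type*} [CStarAlgebra U] (I : Ideal U) [I.IsTwoSided]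
    (hI : IsClosed (I : Set U)) {x : U} (hx : x ∈ I) : star x ∈ I := by
  refine hI.closure_subset (Metric.mem_closure_iff.2 fun ε hε => ?_)
  obtain ⟨u, hu, -, h⟩ := exists_approx x (half_pos hε)
  refine ⟨(u * (star x * x)) * star x,
    I.mul_mem_right _ (I.mul_mem_left _ (I.mul_mem_left _ hx)), ?_⟩
  have : star x - (u * (star x * x)) * star x = star (x - x * (u * (star x * x))) := by
    rw [star_sub, star_mul x, hu.star_eq]
  rw [dist_eq_norm, this, norm_star]
  linarith

universe u

section Quotient

variable {U : Type u} [CStarAlgebra U] (I : Ideal U) [I.IsTwoSided]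

theorem Ideal.Quotient.norm_mul_le_of_isTwoSided (x y : U ⧸ I) : ‖x * y‖ ≤ ‖x‖ * ‖y‖ := by
  refine le_of_forall_pos_le_add fun ε hε => ?_
  have := ((Metric.nhds_basis_ball.prod_nhds Metric.nhds_basis_ball).tendsto_iff
    Metric.nhds_basis_ball).mp (continuous_mul.tendsto (‖x‖, ‖y‖)) ε hε
  simp only [Set.mem_prod, Metric.mem_ball, and_imp, Prod.forall, Prod.exists] at this
  obtain ⟨ε₁, ε₂, ⟨h₁, h₂⟩, h⟩ := this
  obtain ⟨⟨a, rfl, ha⟩, ⟨b, rfl, hb⟩⟩ := And.intro (Submodule.Quotient.norm_mk_lt x h₁)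
    (Submodule.Quotient.norm_mk_lt y h₂)
  simp only [dist, abs_sub_lt_iff] at h
  specialize h ‖a‖ ‖b‖ ⟨by linarith, by linarith [Submodule.Quotient.norm_mk_le I a]⟩
    ⟨by linarith, by linarith [Submodule.Quotient.norm_mk_le I b]⟩
  calc
    _ ≤ ‖a‖ * ‖b‖ := (Submodule.Quotient.norm_mk_le I (a * b)).trans (norm_mul_le a b)
    _ ≤ _ := (sub_lt_iff_lt_add'.mp h.1).le

theorem Ideal.Quotient.norm_sq_le_norm_star_mul_self (x : U) :
    ‖Ideal.Quotient.mk I x‖ * ‖Ideal.Quotient.mk I x‖ ≤ ‖Ideal.Quotient.mk I (star x * x)‖ := by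
  refine le_of_forall_pos_le_add fun ε hε => ?_
  obtain ⟨m, hm, hm'⟩ := Submodule.Quotient.norm_mk_lt (Ideal.Quotient.mk I (star x * x))
    (half_pos hε)
  have hi : m - star x * x ∈ I := (Ideal.Quotient.mk_eq_mk_iff_sub_mem _ _).1 hm
  obtain ⟨u, hu, hu1, h⟩ := exists_approx (m - star x * x) (half_pos hε)
  set i := m - star x * x
  set e := u * (star i * i) with he
  have heI : e ∈ I := I.mul_mem_left _ (I.mul_mem_left _ hi)
  have h1 : ‖Ideal.Quotient.mk I x‖ ≤ ‖x * (1 - e)‖ := by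
    have : Ideal.Quotient.mk I x = Ideal.Quotient.mk I (x * (1 - e)) := by
      refine (Ideal.Quotient.mk_eq_mk_iff_sub_mem _ _).2 ?_
      have : x - x * (1 - e) = x * e := by noncomm_ring
      rw [this]; exact I.mul_mem_left _ heI
    rw [this]
    exact Submodule.Quotient.norm_mk_le I _
  calc _ ≤ ‖x * (1 - e)‖ * ‖x * (1 - e)‖ := by gcongr
    _ = ‖star (x * (1 - e)) * (x * (1 - e))‖ := (CStarRing.norm_star_mul_self).symm
    _ = ‖(1 - e) * (m * (1 - e) - (i - i * e))‖ := by
      congr 1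
      rw [star_mul, star_sub, star_one, hu.star_eq]
      simp only [i]; noncomm_ring
    _ ≤ ‖1 - e‖ * (‖m‖ * ‖1 - e‖ + ‖i - i * e‖) := by
      refine (norm_mul_le _ _).trans ?_
      gcongr
      refine (norm_sub_le _ _).trans ?_
      gcongr
      exact norm_mul_le _ _
    _ ≤ 1 * (‖m‖ * 1 + ε / 2) := by gcongr
    _ ≤ _ := by linarith

theorem exists_quotient_starAlgHom (hI : IsClosed (I : Set U)) :
    ∃ (B : Type u) (_ : CStarAlgebra B) (π : U →⋆ₐ[ℂ] B),
      Function.Surjective π ∧ ∀ x, π x = 0 ↔ x ∈ I := by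
  have : IsClosed (I : Set U) := hI
  let st : StarRing (U ⧸ I) :=
    { star := Quotient.map' star (fun a b h => by
        rw [Submodule.quotientRel_def] at h ⊢
        rw [← star_sub]
        exact star_mem_of_isClosed I hI h)
      star_involutive := by rintro ⟨x⟩; exact congrArg (Ideal.Quotient.mk I) (star_star x)
      star_mul := by
        rintro ⟨x⟩ ⟨y⟩; exact congrArg (Ideal.Quotient.mk I) (star_mul x y)
      star_add := by rintro ⟨x⟩ ⟨y⟩; exact congrArg (Ideal.Quotient.mk I) (star_add x y) }
  let nr : NormedRing (U ⧸ I) :=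
    { Submodule.Quotient.normedAddCommGroup I, (inferInstance : Ring (U ⧸ I)) with
      norm_mul_le := Ideal.Quotient.norm_mul_le_of_isTwoSided I }
  let na : NormedAlgebra ℂ (U ⧸ I) :=
    { Submodule.Quotient.normedSpace I ℂ, (inferInstance : Algebra ℂ (U ⧸ I)) with }
  let cs : CStarAlgebra (U ⧸ I) :=
    { nr, st, na with
      norm_mul_self_le := by
        rintro ⟨x⟩
        exact Ideal.Quotient.norm_sq_le_norm_star_mul_self I x
      star_smul := by
        rintro c ⟨x⟩; exact congrArg (Ideal.Quotient.mk I) (star_smul c x)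
      toCompleteSpace := Submodule.Quotient.completeSpace I }
  refine ⟨U ⧸ I, cs, { Ideal.Quotient.mkₐ ℂ I with map_star' := fun x => rfl },
    Ideal.Quotient.mk_surjective, fun x => Ideal.Quotient.eq_zero_iff_mem⟩

end Quotient

theorem TwoSidedIdeal.exists_isCoatom_le {R : Type*} [Ring R] (J : TwoSidedIdeal R)
    (hJ : (1 : R) ∉ J) : ∃ N : TwoSidedIdeal R, IsCoatom N ∧ J ≤ N := by
  obtain ⟨N, hJN, hN⟩ := zorn_le_nonempty₀ {K : TwoSidedIdeal R | (1 : R) ∉ K}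
    (fun c hc hch K₀ hK₀ => by
    let S : TwoSidedIdeal R := .mk' {x | ∃ K ∈ c, x ∈ K} ⟨K₀, hK₀, K₀.zero_mem⟩
      (by
        rintro x y ⟨K, hK, hx⟩ ⟨L, hL, hy⟩
        rcases hch.total hK hL with h | h
        · exact ⟨L, hL, L.add_mem (h hx) hy⟩
        · exact ⟨K, hK, K.add_mem hx (h hy)⟩)
      (by rintro x ⟨K, hK, hx⟩; exact ⟨K, hK, K.neg_mem hx⟩)
      (by rintro x y ⟨K, hK, hx⟩; exact ⟨K, hK, K.mul_mem_left _ _ hx⟩)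
      (by rintro x y ⟨K, hK, hx⟩; exact ⟨K, hK, K.mul_mem_right _ _ hx⟩)
    have hS : ∀ x, x ∈ S ↔ ∃ K ∈ c, x ∈ K := fun x => by simp [S]
    refine ⟨S, fun h => ?_, fun K hK x hx => (hS x).2 ⟨K, hK, hx⟩⟩
    obtain ⟨K, hK, h1⟩ := (hS 1).1 h
    exact hc hK h1) J hJ
  refine ⟨N, ⟨fun h => hN.prop (h ▸ TwoSidedIdeal.mem_top _), fun K hK => ?_⟩, hJN⟩
  by_contra hKtop
  refine hK.not_ge (hN.le_of_ge (fun h1 => hKtop ?_) hK.le)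
  exact eq_top_iff.2 fun x _ => by simpa using K.mul_mem_left x 1 h1

theorem IsCoatom.one_notMem {R : Type*} [Ring R] {N : TwoSidedIdeal R} (hN : IsCoatom N) :
    (1 : R) ∉ N := fun h1 =>
  hN.1 (eq_top_iff.2 fun x _ => by simpa using N.mul_mem_left x 1 h1)

theorem IsCoatom.algebraMap_mem_iff {U : Type*} [Ring U] [Algebra ℂ U] {N : TwoSidedIdeal U}
    (hN : IsCoatom N) {c : ℂ} : algebraMap ℂ U c ∈ N ↔ c = 0 := by
  refine ⟨fun h => ?_, fun h => by simp [h, N.zero_mem]⟩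
  by_contra hc
  refine hN.one_notMem ?_
  have := N.mul_mem_left (algebraMap ℂ U c⁻¹) _ h
  rwa [← map_mul, inv_mul_cancel₀ hc, map_one] at this

open WeakDual in
theorem exists_isCoatom_of_character {U B C : Type*} [CStarAlgebra U] [CStarAlgebra B]
    [CommCStarAlgebra C] (π : U →⋆ₐ[ℂ] B) (ι : C →⋆ₐ[ℂ] B) (hι : ∀ c, ‖ι c‖ = ‖c‖)
    (hcomm : ∀ c b, ι c * b = b * ι c) (φ : characterSpace ℂ C) :
    ∃ N : TwoSidedIdeal U, IsCoatom N ∧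
      ∀ u c, π u = ι c → (u ∈ N ↔ φ c = 0) := by
  have hφ : ∀ c, ‖φ c‖ ≤ ‖c‖ := fun c => NonUnitalStarAlgHom.norm_apply_le φ c
  let J : TwoSidedIdeal U := .mk'
    {x | ∀ ε : ℝ, 0 < ε → ∃ c : C, φ c = 1 ∧ ‖c‖ ≤ 1 ∧ ‖ι c * π x‖ ≤ ε}
    (fun ε hε => ⟨1, map_one φ, by
      rw [← hι, map_one]
      rcases subsingleton_or_nontrivial B with h | h
      · rw [Subsingleton.elim (1 : B) 0, norm_zero]; exact zero_le_one
      · exact CStarRing.norm_one.le, by simpa using hε.le⟩)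
    (by
      intro x y hx hy ε hε
      obtain ⟨c, hc, hc1, hcx⟩ := hx (ε / 2) (half_pos hε)
      obtain ⟨d, hd, hd1, hdy⟩ := hy (ε / 2) (half_pos hε)
      refine ⟨c * d, by simp [hc, hd],
        (norm_mul_le _ _).trans (mul_le_one₀ hc1 (norm_nonneg _) hd1), ?_⟩
      have : ι (c * d) * π (x + y) = ι d * (ι c * π x) + ι c * (ι d * π y) := by
        rw [map_mul, map_add, mul_add, ← mul_assoc, hcomm d (ι c), mul_assoc, mul_assoc]
      rw [this]
      calc _ ≤ ‖ι d‖ * ‖ι c * π x‖ + ‖ι c‖ * ‖ι d * π y‖ :=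
            (norm_add_le _ _).trans (add_le_add (norm_mul_le _ _) (norm_mul_le _ _))
        _ ≤ 1 * (ε / 2) + 1 * (ε / 2) := by
          rw [hι, hι]; gcongr
        _ = ε := by ring)
    (by
      intro x hx ε hε
      obtain ⟨c, hc, hc1, hcx⟩ := hx ε hε
      exact ⟨c, hc, hc1, by simpa using hcx⟩)
    (by
      intro x y hy ε hε
      obtain ⟨c, hc, hc1, hcy⟩ := hy (ε / (‖π x‖ + 1)) (by positivity)
      refine ⟨c, hc, hc1, ?_⟩
      rw [map_mul, ← mul_assoc, hcomm, mul_assoc]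
      refine (norm_mul_le _ _).trans ?_
      calc _ ≤ (‖π x‖ + 1) * (ε / (‖π x‖ + 1)) := by gcongr; linarith
        _ = ε := by field_simp)
    (by
      intro x y hy ε hε
      obtain ⟨c, hc, hc1, hcy⟩ := hy (ε / (‖π y‖ + 1)) (by positivity)
      refine ⟨c, hc, hc1, ?_⟩
      rw [map_mul, ← mul_assoc]
      refine (norm_mul_le _ _).trans ?_
      calc _ ≤ (ε / (‖π y‖ + 1)) * (‖π y‖ + 1) := by gcongr; linarith
        _ = ε := by field_simp)
  have hJ : ∀ x, x ∈ J ↔ ∀ ε : ℝ, 0 < ε → ∃ c : C, φ c = 1 ∧ ‖c‖ ≤ 1 ∧ ‖ι c * π x‖ ≤ ε :=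
    fun x => by simp only [J, TwoSidedIdeal.mem_mk', Set.mem_ofPred_eq]
  obtain ⟨N, hN, hJN⟩ := J.exists_isCoatom_le (fun h => by
    obtain ⟨c, hc, -, hc1⟩ := (hJ 1).1 h (1 / 2) (by norm_num)
    have := hφ c
    rw [map_one, mul_one, hι] at hc1
    rw [hc, norm_one] at this
    linarith)
  have key : ∀ u c, π u = ι c → φ c = 0 → u ∈ N := by
    intro u c huc hc
    refine hJN ((hJ u).2 fun ε hε => ?_)
    obtain ⟨v, -, hv1, hv⟩ := exists_approx c hε
    refine ⟨1 - v * (star c * c), by simp [hc], hv1, ?_⟩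
    rw [huc, ← map_mul, hι]
    convert hv using 2
    ring
  refine ⟨N, hN, fun u c huc => ⟨fun hu => ?_, key u c huc⟩⟩
  have h1 : u - algebraMap ℂ U (φ c) ∈ N := by
    refine key _ (c - algebraMap ℂ C (φ c)) (by simp [huc, AlgHomClass.commutes]) ?_
    simp [AlgHomClass.commutes]
  have h2 := N.sub_mem hu h1
  rwa [sub_sub_cancel, hN.algebraMap_mem_iff] at h2

/-- The centre of a star algebra as a star subalgebra. -/
def centerStarSubalgebra (B : Type*) [CStarAlgebra B] : StarSubalgebra ℂ B :=
  { Subalgebra.center ℂ B with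
    star_mem' := fun {_} ha => Set.star_mem_center ha }

theorem mem_centerStarSubalgebra {B : Type*} [CStarAlgebra B] {b : B} :
    b ∈ centerStarSubalgebra B ↔ ∀ x, x * b = b * x :=
  Subalgebra.mem_center_iff

theorem isClosed_centerStarSubalgebra (B : Type*) [CStarAlgebra B] :
    IsClosed (centerStarSubalgebra B : Set B) := by
  have : (centerStarSubalgebra B : Set B) = Set.centralizer Set.univ := by
    rw [Set.centralizer_univ]; rfl
  rw [this]
  exact Set.isClosed_centralizer _

open WeakDual in
theorem exists_center_lift {U B : Type*} [CStarAlgebra U] [CStarAlgebra B] (π : U →⋆ₐ[ℂ] B)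
    (hπ : Function.Surjective π)
    (H : ∀ N₁ N₂ : TwoSidedIdeal U, IsCoatom N₁ → IsCoatom N₂ →
      (∀ z ∈ centerStarSubalgebra U, z ∈ N₁ ↔ z ∈ N₂) → N₁ = N₂)
    {b : B} (hb : b ∈ centerStarSubalgebra B) : ∃ z ∈ centerStarSubalgebra U, π z = b := by
  have hU := isClosed_centerStarSubalgebra U
  have hB := isClosed_centerStarSubalgebra B
  let C := centerStarSubalgebra B
  let iC : CStarAlgebra C := StarSubalgebra.cstarAlgebra C
  let cC : CommCStarAlgebra C :=
    { iC with mul_comm := fun x y => Subtype.ext (mem_centerStarSubalgebra.1 y.2 x) }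
  let E : CStarAlgebra (centerStarSubalgebra U) := StarSubalgebra.cstarAlgebra _
  let ψ : centerStarSubalgebra U →⋆ₐ[ℂ] B := π.comp (centerStarSubalgebra U).subtype
  have hψ : IsClosed (Set.range ψ) := isClosed_range_starAlgHom ψ
  have hmap : ∀ z ∈ centerStarSubalgebra U, π z ∈ C := fun z hz =>
    mem_centerStarSubalgebra.2 fun y => by
      obtain ⟨x, rfl⟩ := hπ y
      rw [← map_mul, ← map_mul, mem_centerStarSubalgebra.1 hz]
  let D : StarSubalgebra ℂ C := ψ.range.comap C.subtype
  have hD : IsClosed (D : Set C) := by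
    have : (D : Set C) = Subtype.val ⁻¹' Set.range ψ := rfl
    rw [this]
    exact hψ.preimage continuous_subtype_val
  let g : C(characterSpace ℂ C, ℂ) →⋆ₐ[ℂ] C := (gelfandStarTransform C).symm
  have hg : Continuous g := AddMonoidHomClass.continuous_of_bound g 1
      (fun x => by simpa using NonUnitalStarAlgHom.norm_apply_le g x)
  let D' : StarSubalgebra ℂ C(characterSpace ℂ C, ℂ) := D.comap g
  have hD' : IsClosed (D' : Set C(characterSpace ℂ C, ℂ)) := hD.preimage hg
  have hsep : D'.SeparatesPoints := by
    intro φ₁ φ₂ hne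
    by_contra! hall
    apply hne
    have hφ : ∀ z ∈ centerStarSubalgebra U, ∀ c : C, π z = c → φ₁ c = φ₂ c := by
      intro z hz c hzc
      have hc : g (gelfandStarTransform C c) = c := (gelfandStarTransform C).symm_apply_apply c
      have hD : gelfandStarTransform C c ∈ D' := by
        change g _ ∈ D
        rw [hc]
        exact ⟨⟨z, hz⟩, hzc⟩
      exact hall _ ⟨_, hD, rfl⟩
    have hι : ∀ c : C, ‖C.subtype c‖ = ‖c‖ := fun _ => rfl
    have hcomm : ∀ (c : C) (b : B), C.subtype c * b = b * C.subtype c :=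
      fun c b => (mem_centerStarSubalgebra.1 c.2 b).symm
    obtain ⟨N₁, hN₁, h₁⟩ := exists_isCoatom_of_character π C.subtype hι hcomm φ₁
    obtain ⟨N₂, hN₂, h₂⟩ := exists_isCoatom_of_character π C.subtype hι hcomm φ₂
    obtain rfl : N₁ = N₂ := H _ _ hN₁ hN₂ fun z hz => by
      rw [h₁ z ⟨π z, hmap z hz⟩ rfl, h₂ z ⟨π z, hmap z hz⟩ rfl, hφ z hz _ rfl]
    refine CharacterSpace.ext fun c => ?_
    obtain ⟨u, hu⟩ := hπ (c - algebraMap ℂ B (φ₁ c))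
    have e := (h₁ u (c - algebraMap ℂ C (φ₁ c)) (by simp [hu])).2
      (by simp [AlgHomClass.commutes])
    have e' := (h₂ u (c - algebraMap ℂ C (φ₁ c)) (by simp [hu])).1 e
    rw [map_sub, AlgHomClass.commutes, sub_eq_zero] at e'
    simpa using e'.symm
  have htop := ContinuousMap.starSubalgebra_topologicalClosure_eq_top_of_separatesPoints D' hsep
  have hall : ∀ f, f ∈ D' := fun f => by
    have : f ∈ D'.topologicalClosure := htop ▸ StarSubalgebra.mem_top
    rw [← SetLike.mem_coe, StarSubalgebra.topologicalClosure_coe, hD'.closure_eq] at this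
    exact this
  have h : g (gelfandStarTransform C ⟨b, hb⟩) ∈ D := hall _
  rw [show g (gelfandStarTransform C ⟨b, hb⟩) = ⟨b, hb⟩ from
    (gelfandStarTransform C).symm_apply_apply _] at h
  obtain ⟨z, hz⟩ := h
  exact ⟨z, z.2, hz⟩

theorem IsCoatom.isClosed {U : Type*} [NormedRing U] [CompleteSpace U] {N : TwoSidedIdeal U}
    (hN : IsCoatom N) : IsClosed (N : Set U) := by
  let K : TwoSidedIdeal U := .mk' (closure N) (subset_closure N.zero_mem)
    (fun hx hy => map_mem_closure₂ continuous_add hx hy fun _ ha _ hb => N.add_mem ha hb)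
    (fun hx => map_mem_closure continuous_neg hx fun _ ha => N.neg_mem ha)
    (fun hy => map_mem_closure (continuous_const_mul _) hy fun _ ha => N.mul_mem_left _ _ ha)
    (fun {_ y} hx => map_mem_closure (f := fun t => t * y) (continuous_mul_const y) hx
      fun _ ha => N.mul_mem_right _ _ ha)
  have hK : ∀ x, x ∈ K ↔ x ∈ closure (N : Set U) := fun x => by
    simp only [K, TwoSidedIdeal.mem_mk']
  have hNK : N ≤ K := fun x hx => (hK x).2 (subset_closure hx)
  rcases hNK.eq_or_lt with h | h
  · refine isClosed_of_closure_subset fun x hx => ?_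
    have := (hK x).2 hx
    rwa [← h] at this
  · have h1 : (1 : U) ∈ closure (N : Set U) := (hK 1).1 (hN.2 K h ▸ TwoSidedIdeal.mem_top _)
    obtain ⟨x, hx, hx1⟩ := Metric.mem_closure_iff.1 h1 1 one_pos
    rw [dist_eq_norm] at hx1
    obtain ⟨v, hv⟩ := isUnit_one_sub_of_norm_lt_one hx1
    rw [sub_sub_cancel] at hv
    refine absurd ?_ hN.one_notMem
    rw [← v.inv_mul, hv]
    exact N.mul_mem_left _ _ hx

section Unitization

variable {A : Type*} [NonUnitalCStarAlgebra A]

open Unitization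

theorem CQP.IsIdealOf.smul_mem_s4 {I : Set A} (hI : IsIdealOf I Set.univ) (c : ℂ) {x : A}
    (hx : x ∈ I) : c • x ∈ I := by
  obtain ⟨-, hcl, h0, hadd, hneg, hmul⟩ := hI
  refine hcl.closure_subset (Metric.mem_closure_iff.2 fun ε hε => ?_)
  obtain ⟨u, -, -, hu⟩ := exists_approx (x : Unitization ℂ A)
    (show 0 < ε / (‖c‖ + 1) by positivity)
  obtain ⟨y, hy⟩ : ∃ y : A, (y : Unitization ℂ A) = u * star (x : Unitization ℂ A) :=
    ⟨(u * star (x : Unitization ℂ A)).snd, by ext <;> simp⟩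
  refine ⟨(c • x) * (y * x), (hmul _ (hmul x hx y trivial).1 _ trivial).1, ?_⟩
  rw [← mul_assoc u, ← hy, ← inr_mul, ← inr_mul, ← inr_sub, norm_inr] at hu
  rw [dist_eq_norm, smul_mul_assoc, ← smul_sub, norm_smul]
  calc _ ≤ ‖c‖ * (ε / (‖c‖ + 1)) := by gcongr
    _ < (‖c‖ + 1) * (ε / (‖c‖ + 1)) := by gcongr; linarith
    _ = ε := by field_simp

/-- A closed two-sided ideal of `A`, viewed as an ideal of the unitization. -/
def CQP.IsIdealOf.unitizationIdeal {I : Set A} (hI : IsIdealOf I Set.univ) :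
    Ideal (Unitization ℂ A) where
  carrier := inr '' I
  zero_mem' := ⟨0, hI.2.2.1, inr_zero ℂ⟩
  add_mem' := by
    rintro _ _ ⟨x, hx, rfl⟩ ⟨y, hy, rfl⟩
    exact ⟨x + y, hI.2.2.2.1 x hx y hy, inr_add ℂ x y⟩
  smul_mem' := by
    rintro c _ ⟨x, hx, rfl⟩
    exact ⟨c.fst • x + c.snd * x,
      hI.2.2.2.1 _ (hI.smul_mem_s4 _ hx) _ (hI.2.2.2.2.2 x hx _ trivial).1, by ext <;> simp⟩

theorem CQP.IsIdealOf.inr_mem_unitizationIdeal {I : Set A} (hI : IsIdealOf I Set.univ) {x : A} :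
    (x : Unitization ℂ A) ∈ hI.unitizationIdeal ↔ x ∈ I :=
  inr_injective.mem_set_image

instance CQP.IsIdealOf.isTwoSided_unitizationIdeal {I : Set A} (hI : IsIdealOf I Set.univ) :
    hI.unitizationIdeal.IsTwoSided where
  mul_mem_of_left := by
    rintro _ c ⟨x, hx, rfl⟩
    exact ⟨c.fst • x + x * c.snd,
      hI.2.2.2.1 _ (hI.smul_mem_s4 _ hx) _ (hI.2.2.2.2.2 x hx _ trivial).2, by ext <;> simp⟩

theorem CQP.IsIdealOf.isClosed_unitizationIdeal {I : Set A} (hI : IsIdealOf I Set.univ) :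
    IsClosed (hI.unitizationIdeal : Set (Unitization ℂ A)) :=
  (isometry_inr (𝕜 := ℂ) (A := A)).isClosedEmbedding.isClosedMap _ hI.2.1

theorem inr_mem_centerStarSubalgebra_iff {z : A} :
    (z : Unitization ℂ A) ∈ centerStarSubalgebra (Unitization ℂ A) ↔
      z ∈ centerOf (Set.univ : Set A) := by
  rw [mem_centerStarSubalgebra]
  refine ⟨fun h => ⟨trivial, fun x _ => ?_⟩, fun h x => ?_⟩
  · have := h x
    rw [← inr_mul, ← inr_mul] at this
    exact (inr_injective this).symm
  · ext
    · simp
    · simp [h.2 x.snd trivial]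

theorem isModMaxIdealOf_preimage_inr {N : TwoSidedIdeal (Unitization ℂ A)} (hN : IsCoatom N)
    (hNA : ¬ ∀ a : A, (a : Unitization ℂ A) ∈ N) :
    IsModMaxIdealOf {a : A | (a : Unitization ℂ A) ∈ N} Set.univ := by
  push Not at hNA
  obtain ⟨a₀, ha₀⟩ := hNA
  have hsup : ∀ J : TwoSidedIdeal (Unitization ℂ A), ¬ J ≤ N → ∃ n ∈ N, ∃ j ∈ J, n + j = 1 := by
    intro J hJ
    have h1 : (1 : Unitization ℂ A) ∈ N ⊔ J := by
      rw [hN.2 _ (left_lt_sup.2 hJ)]; trivial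
    exact TwoSidedIdeal.mem_sup.1 h1
  have hup : ∀ (I : Set A) (hI : IsIdealOf I Set.univ), ¬ (∀ a ∈ I, (a : Unitization ℂ A) ∈ N) →
      ∃ n ∈ N, ∃ j ∈ I, n + (j : Unitization ℂ A) = 1 := by
    intro I hI h
    obtain ⟨n, hn, j, hj, hnj⟩ := hsup hI.unitizationIdeal.toTwoSided (fun hle =>
      h fun a ha => hle (Ideal.mem_toTwoSided.2 (hI.inr_mem_unitizationIdeal.2 ha)))
    obtain ⟨j, hjI, rfl⟩ := Ideal.mem_toTwoSided.1 hj
    exact ⟨n, hn, j, hjI, hnj⟩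
  refine ⟨⟨Set.subset_univ _, hN.isClosed.preimage (isometry_inr (𝕜 := ℂ) (A := A)).continuous,
    ?_, ?_, ?_, ?_⟩, fun h => ha₀ ((Set.ext_iff.1 h a₀).2 trivial), ?_, ?_⟩
  · simp
  · intro x hx y hy
    simpa using N.add_mem hx hy
  · intro x hx
    simpa using N.neg_mem hx
  · intro x hx a _
    exact ⟨by simpa using N.mul_mem_left a _ hx, by simpa using N.mul_mem_right _ a hx⟩
  · intro I hI hle
    by_cases h : ∀ a ∈ I, (a : Unitization ℂ A) ∈ N
    · exact .inl (Set.Subset.antisymm h hle)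
    · right
      obtain ⟨n, hn, j, hj, hnj⟩ := hup I hI h
      refine Set.eq_univ_of_forall fun x => ?_
      have h1 : x - x * j ∈ I := hle (by
        change ((x - x * j : A) : Unitization ℂ A) ∈ N
        have : ((x - x * j : A) : Unitization ℂ A) = x * n := by
          rw [eq_sub_of_add_eq hnj, mul_sub, mul_one, inr_sub, inr_mul]
        rw [this]
        exact N.mul_mem_left _ _ hn)
      have := hI.2.2.2.1 _ h1 _ (hI.2.2.2.2.2 j hj x trivial).1
      rwa [sub_add_cancel] at this
  · have hU : IsIdealOf (Set.univ : Set A) Set.univ := by simp [IsIdealOf]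
    obtain ⟨n, hn, e, -, hne⟩ := hup _ hU fun h => ha₀ (h a₀ trivial)
    refine ⟨e, trivial, fun x _ => ⟨?_, ?_⟩⟩
    · have : ((x - x * e : A) : Unitization ℂ A) = x * n := by
        rw [eq_sub_of_add_eq hne, mul_sub, mul_one, inr_sub, inr_mul]
      change ((x - x * e : A) : Unitization ℂ A) ∈ N
      rw [this]
      exact N.mul_mem_left _ _ hn
    · have : ((x - e * x : A) : Unitization ℂ A) = n * x := by
        rw [eq_sub_of_add_eq hne, sub_mul, one_mul, inr_sub, inr_mul]
      change ((x - e * x : A) : Unitization ℂ A) ∈ N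
      rw [this]
      exact N.mul_mem_right _ _ hn

theorem IsCoatom.le_of_inr_mem_imp {N₁ N₂ : TwoSidedIdeal (Unitization ℂ A)} (h₂ : IsCoatom N₂)
    (hA : ¬ ∀ a : A, (a : Unitization ℂ A) ∈ N₂)
    (h : ∀ a : A, (a : Unitization ℂ A) ∈ N₁ → (a : Unitization ℂ A) ∈ N₂) : N₁ ≤ N₂ := by
  by_contra hle
  apply hA
  intro a
  have h1 : (1 : Unitization ℂ A) ∈ N₂ ⊔ N₁ := by
    rw [h₂.2 _ (left_lt_sup.2 hle)]; trivial
  obtain ⟨n, hn, j, hj, hnj⟩ := TwoSidedIdeal.mem_sup.1 h1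
  have hja : j * a ∈ N₂ := by
    have e : ((j * (a : Unitization ℂ A)).snd : Unitization ℂ A) = j * a := by
      ext <;> simp
    rw [← e]
    refine h _ ?_
    rw [e]
    exact N₁.mul_mem_right _ _ hj
  rw [← one_mul (a : Unitization ℂ A), ← hnj, add_mul]
  exact N₂.add_mem (N₂.mul_mem_right _ _ hn) hja

theorem IsCoatom.mem_iff_fst_eq_zero {N : TwoSidedIdeal (Unitization ℂ A)} (hN : IsCoatom N)
    (hA : ∀ a : A, (a : Unitization ℂ A) ∈ N) (x : Unitization ℂ A) : x ∈ N ↔ x.fst = 0 := by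
  rw [← hN.algebraMap_mem_iff, algebraMap_eq_inl]
  conv_lhs => rw [← inl_fst_add_inr_snd_eq x]
  exact ⟨fun h => by simpa using N.sub_mem h (hA x.snd), fun h => N.add_mem h (hA _)⟩

theorem CQP.WeaklyCentral.isCoatom_eq (hA : WeaklyCentral (Set.univ : Set A))
    {N₁ N₂ : TwoSidedIdeal (Unitization ℂ A)} (h₁ : IsCoatom N₁) (h₂ : IsCoatom N₂)
    (h : ∀ z ∈ centerStarSubalgebra (Unitization ℂ A), z ∈ N₁ ↔ z ∈ N₂) : N₁ = N₂ := by
  have hc : ∀ z ∈ centerOf (Set.univ : Set A),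
      ((z : Unitization ℂ A) ∈ N₁ ↔ (z : Unitization ℂ A) ∈ N₂) := fun z hz =>
    h _ (inr_mem_centerStarSubalgebra_iff.2 hz)
  by_cases hA₁ : ∀ a : A, (a : Unitization ℂ A) ∈ N₁ <;>
    by_cases hA₂ : ∀ a : A, (a : Unitization ℂ A) ∈ N₂
  · ext x
    rw [h₁.mem_iff_fst_eq_zero hA₁, h₂.mem_iff_fst_eq_zero hA₂]
  · exact absurd (fun z hz => (hc z hz).1 (hA₁ z))
      (hA.1 _ (isModMaxIdealOf_preimage_inr h₂ hA₂))
  · exact absurd (fun z hz => (hc z hz).2 (hA₂ z))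
      (hA.1 _ (isModMaxIdealOf_preimage_inr h₁ hA₁))
  · have := hA.2 _ _ (isModMaxIdealOf_preimage_inr h₁ hA₁) (isModMaxIdealOf_preimage_inr h₂ hA₂)
      (Set.ext fun z => and_congr_left fun hz => hc z hz)
    have := Set.ext_iff.1 this
    exact le_antisymm (h₂.le_of_inr_mem_imp hA₂ fun a => (this a).1)
      (h₁.le_of_inr_mem_imp hA₁ fun a => (this a).2)

theorem CQP.WeaklyCentral.hasCQ (hA : WeaklyCentral (Set.univ : Set A)) :
    HasCQ (Set.univ : Set A) := by
  intro I hI a _ ha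
  obtain ⟨B, _, π, hπ, hker⟩ :=
    exists_quotient_starAlgHom hI.unitizationIdeal hI.isClosed_unitizationIdeal
  have hb : π (a : Unitization ℂ A) ∈ centerStarSubalgebra B := by
    refine mem_centerStarSubalgebra.2 fun y => ?_
    obtain ⟨x, rfl⟩ := hπ y
    rw [eq_comm, ← sub_eq_zero, ← map_mul, ← map_mul, ← map_sub, hker]
    have : (a : Unitization ℂ A) * x - x * a = (a * x.snd - x.snd * a : A) := by
      have h₁ : (a : Unitization ℂ A) * x = (x.fst • a + a * x.snd : A) := by ext <;> simp
      have h₂ : x * (a : Unitization ℂ A) = (x.fst • a + x.snd * a : A) := by ext <;> simp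
      rw [h₁, h₂, ← inr_sub, add_sub_add_left_eq_sub]
    rw [this]
    exact hI.inr_mem_unitizationIdeal.2 (ha _ trivial)
  obtain ⟨z, hz, hza⟩ := exists_center_lift π hπ (fun _ _ h₁ h₂ => hA.isCoatom_eq h₁ h₂) hb
  rw [eq_comm, ← sub_eq_zero, ← map_sub, hker] at hza
  obtain ⟨i, hi, hi'⟩ := hza
  have hz' : z = ((a - i : A) : Unitization ℂ A) := by
    rw [inr_sub, hi', sub_sub_cancel]
  exact ⟨a - i, inr_mem_centerStarSubalgebra_iff.1 (hz' ▸ hz), by rwa [sub_sub_cancel]⟩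

theorem exists_sub_mul_eq {d : A} (hd : ‖d‖ < 1) (e : A) : ∃ b : A, b - b * d = e := by
  obtain ⟨v, hv⟩ := isUnit_one_sub_of_norm_lt_one
    (show ‖(d : Unitization ℂ A)‖ < 1 by rwa [norm_inr])
  set w : Unitization ℂ A := ((v⁻¹ : (Unitization ℂ A)ˣ) : Unitization ℂ A)
  have hb : (((e : Unitization ℂ A) * w).snd : Unitization ℂ A) = e * w := by
    ext <;> simp
  refine ⟨((e : Unitization ℂ A) * w).snd, inr_injective (R := ℂ) ?_⟩
  rw [inr_sub, inr_mul, hb]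
  calc _ = (e : Unitization ℂ A) * (w * (1 - d)) := by noncomm_ring
    _ = e := by rw [← hv, v.inv_mul, mul_one]

theorem CQP.IsModMaxIdealOf.notMem {M : Set A} (hM : IsModMaxIdealOf M Set.univ) {e : A}
    (he : IsRelUnitMod Set.univ M e) : e ∉ M := by
  intro h
  obtain ⟨⟨-, -, -, hadd, -, hmul⟩, hne, -⟩ := hM
  refine hne (Set.eq_univ_of_forall fun x => ?_)
  have := hadd _ (he.2 x trivial).1 _ (hmul e h x trivial).1
  rwa [sub_add_cancel] at this

theorem CQP.IsModMaxIdealOf.exists_add_mem_closure {M N : Set A} (hM : IsModMaxIdealOf M Set.univ)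
    (hN : IsModMaxIdealOf N Set.univ) (hMN : M ≠ N) (e : A) :
    e ∈ closure {x : A | ∃ m ∈ M, ∃ n ∈ N, m + n = x} := by
  obtain ⟨⟨-, -, hM0, hMa, hMn, hMm⟩, hM1, hM2, -⟩ := id hM
  obtain ⟨⟨-, -, hN0, hNa, hNn, hNm⟩, hN1, hN2, -⟩ := hN
  set S : Set A := {x : A | ∃ m ∈ M, ∃ n ∈ N, m + n = x}
  have hMS : M ⊆ closure S := fun m hm => subset_closure ⟨m, hm, 0, hN0, add_zero _⟩
  have hNS : N ⊆ closure S := fun n hn => subset_closure ⟨0, hM0, n, hn, zero_add _⟩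
  have hS : IsIdealOf (closure S) Set.univ := by
    refine ⟨Set.subset_univ _, isClosed_closure, hMS hM0, fun x hx y hy => ?_, fun x hx => ?_,
      fun x hx a _ => ⟨?_, ?_⟩⟩
    · refine map_mem_closure₂ continuous_add hx hy ?_
      rintro _ ⟨m, hm, n, hn, rfl⟩ _ ⟨m', hm', n', hn', rfl⟩
      exact ⟨m + m', hMa _ hm _ hm', n + n', hNa _ hn _ hn', by abel⟩
    · refine map_mem_closure continuous_neg hx ?_
      rintro _ ⟨m, hm, n, hn, rfl⟩
      exact ⟨-m, hMn _ hm, -n, hNn _ hn, by abel⟩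
    · refine map_mem_closure (continuous_const_mul a) hx ?_
      rintro _ ⟨m, hm, n, hn, rfl⟩
      exact ⟨_, (hMm m hm a trivial).1, _, (hNm n hn a trivial).1, (mul_add _ _ _).symm⟩
    · refine map_mem_closure (f := fun t => t * a) (continuous_mul_const a) hx ?_
      rintro _ ⟨m, hm, n, hn, rfl⟩
      exact ⟨_, (hMm m hm a trivial).2, _, (hNm n hn a trivial).2, (add_mul _ _ _).symm⟩
  rcases hM2 _ hS hMS with h | h
  · rcases hN2 M hM.1 (h ▸ hNS) with h' | h'
    · exact absurd h' hMN
    · exact absurd h' hM1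
  · rw [h]; trivial

theorem CQP.IsModMaxIdealOf.exists_mem_sub_mem {M N : Set A} (hM : IsModMaxIdealOf M Set.univ)
    (hN : IsModMaxIdealOf N Set.univ) (hMN : M ≠ N) {e : A} (he : IsRelUnitMod Set.univ M e) :
    ∃ f ∈ N, f - e ∈ M := by
  obtain ⟨_, ⟨m, hm, n, hn, rfl⟩, hd⟩ :=
    Metric.mem_closure_iff.1 (hM.exists_add_mem_closure hN hMN e) 1 one_pos
  rw [dist_eq_norm] at hd
  obtain ⟨b, hb⟩ := exists_sub_mul_eq hd e
  obtain ⟨-, -, hM0, hMa, hMn, hMm⟩ := hM.1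
  refine ⟨b * n, (hN.1.2.2.2.2.2 n hn b trivial).1, ?_⟩
  have : b * n - e = -(b - b * e) + -(b * m) := by
    conv_lhs => rw [← hb]
    noncomm_ring
  rw [this]
  exact hMa _ (hMn _ (he.2 b trivial).1) _ (hMn _ (hMm m hm b trivial).1)

theorem CQP.HasCQ.weaklyCentral (hA : HasCQ (Set.univ : Set A)) :
    WeaklyCentral (Set.univ : Set A) := by
  have hcomm : ∀ {M : Set A} {e : A}, IsModMaxIdealOf M Set.univ → IsRelUnitMod Set.univ M e →
      ∀ x, e * x - x * e ∈ M := by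
    intro M e hM he x
    have := hM.1.2.2.2.1 _ (he.2 x trivial).1 _ (hM.1.2.2.2.2.1 _ (he.2 x trivial).2)
    convert this using 1
    abel
  constructor
  · intro M hM hZ
    obtain ⟨e, he⟩ := hM.2.2.2
    obtain ⟨z, hz, hez⟩ := hA M hM.1 e trivial fun x _ => hcomm hM he x
    have := hM.1.2.2.2.1 _ hez _ (hZ hz)
    rw [sub_add_cancel] at this
    exact hM.notMem he this
  · intro M N hM hN hZ
    by_contra hMN
    obtain ⟨e, he⟩ := hM.2.2.2
    obtain ⟨f, hfN, hfM⟩ := hM.exists_mem_sub_mem hN hMN he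
    obtain ⟨-, hMc, hM0, hMa, hMn, hMm⟩ := id hM.1
    obtain ⟨-, hNc, hN0, hNa, hNn, hNm⟩ := id hN.1
    have hI : IsIdealOf (M ∩ N) Set.univ :=
      ⟨Set.subset_univ _, hMc.inter hNc, ⟨hM0, hN0⟩,
        fun x hx y hy => ⟨hMa _ hx.1 _ hy.1, hNa _ hx.2 _ hy.2⟩,
        fun x hx => ⟨hMn _ hx.1, hNn _ hx.2⟩,
        fun x hx a ha => ⟨⟨(hMm _ hx.1 a ha).1, (hNm _ hx.2 a ha).1⟩,
          (hMm _ hx.1 a ha).2, (hNm _ hx.2 a ha).2⟩⟩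
    obtain ⟨z, hz, hfz⟩ := hA _ hI f trivial fun x _ => by
      constructor
      · have := hMa _ (hMa _ (hMm _ hfM x trivial).2 _ (hMn _ (hMm _ hfM x trivial).1)) _
          (hcomm hM he x)
        convert this using 1
        noncomm_ring
      · have := hNa _ (hNm _ hfN x trivial).2 _ (hNn _ (hNm _ hfN x trivial).1)
        rwa [← sub_eq_add_neg] at this
    have hzN : z ∈ N := by
      have := hNa _ (hNn _ hfz.2) _ hfN
      rwa [neg_sub, sub_add_cancel] at this
    have hzM : z ∈ M := ((Set.ext_iff.1 hZ z).2 ⟨hzN, hz⟩).1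
    refine hM.notMem he ?_
    have := hMa _ (hMa _ (hMn _ hfM) _ hfz.1) _ hzM
    convert this using 1
    abel

end Unitization

/-- **Corollary 3.9.** A C*-algebra `A` (not necessarily unital) has the CQ-property
if and only if `A` is weakly central. -/
theorem stmt4 {A : Type*} [NonUnitalCStarAlgebra A] :
    HasCQ (Set.univ : Set A) ↔ WeaklyCentral (Set.univ : Set A) :=
  ⟨fun h => h.weaklyCentral, fun h => h.hasCQ⟩
end

section
/- Let A be a C*-algebra. Then every weakly central ideal J of A is contained in ker T_A, the intersection of all members of T_A. -/
open Filter Topology Pointwise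

open CQP

section WeaklyCentralIdeals

variable {A : Type*} [NonUnitalCStarAlgebra A]

/-- The closure of an algebraic two-sided ideal is a closed two-sided ideal. -/
theorem isIdealOf_closure {K : Set A} (h0 : (0 : A) ∈ K)
    (hadd : ∀ x ∈ K, ∀ y ∈ K, x + y ∈ K) (hneg : ∀ x ∈ K, -x ∈ K)
    (hmul : ∀ x ∈ K, ∀ a, a * x ∈ K ∧ x * a ∈ K) :
    IsIdealOf (closure K) (Set.univ : Set A) :=
  ⟨Set.subset_univ _, isClosed_closure, subset_closure h0,
    fun _ hx _ hy => map_mem_closure₂ continuous_add hx hy hadd,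
    fun _ hx => map_mem_closure continuous_neg hx hneg,
    fun _ hx a _ =>
      ⟨map_mem_closure (continuous_const_mul a) hx fun y hy => (hmul y hy a).1,
        map_mem_closure (f := (· * a)) (continuous_mul_const a) hx fun y hy => (hmul y hy a).2⟩⟩

theorem exists_sub_mul_eq_of_norm_lt_one {y : A} (hy : ‖y‖ < 1) :
    ∃ w : A, w - w * y = y := by
  have hy' : ‖(y : Unitization ℂ A)‖ < 1 := by rwa [Unitization.norm_inr]
  let u := Units.oneSub (y : Unitization ℂ A) hy'
  have h : (↑u⁻¹ : Unitization ℂ A) = 1 + ↑u⁻¹ * y := by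
    rw [← sub_eq_iff_eq_add, ← mul_one_sub]
    exact u.inv_mul
  have hfst := congrArg (fun x => x.fst) h
  have hsnd := congrArg (fun x => x.snd) h
  simp at hfst
  simp [hfst] at hsnd
  exact ⟨_, sub_eq_iff_eq_add.2 hsnd⟩

/-- A dense left ideal containing `x - x * e` for all `x` contains the relative unit `e`. -/
theorem relUnit_mem_of_dense {K : Set A} {e : A}
    (hadd : ∀ x ∈ K, ∀ y ∈ K, x + y ∈ K) (hmul : ∀ x ∈ K, ∀ a, a * x ∈ K)
    (he : ∀ x, x - x * e ∈ K) (hK : closure K = Set.univ) : e ∈ K := by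
  obtain ⟨k, hk, hek⟩ := Metric.mem_closure_iff.1 (hK ▸ Set.mem_univ e) 1 one_pos
  rw [dist_eq_norm] at hek
  obtain ⟨w, hw⟩ := exists_sub_mul_eq_of_norm_lt_one hek
  have key : e = (w * k + (w - w * e)) + k := by
    rw [mul_sub] at hw
    rw [← sub_eq_iff_eq_add, ← hw]
    abel
  rw [key]
  exact hadd _ (hadd _ (hmul k hk w) _ (he w)) _ hk

/-- If `I` is an ideal not contained in the modular maximal ideal `M`, then every relative unit
for `M` lies in `I + M`. -/
theorem relUnit_mem_add {I M : Set A} {e : A} (hI : IsIdealOf I (Set.univ : Set A))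
    (hM : IsModMaxIdealOf M (Set.univ : Set A)) (he : IsRelUnitMod Set.univ M e)
    (hIM : ¬ I ⊆ M) : e ∈ I + M := by
  obtain ⟨-, -, I0, Iadd, Ineg, Imul⟩ := hI
  obtain ⟨⟨-, -, M0, Madd, Mneg, Mmul⟩, -, hmax, -⟩ := hM
  have hM_sub : M ⊆ I + M := fun m hm => ⟨0, I0, m, hm, zero_add m⟩
  have hI_sub : I ⊆ I + M := fun i hi => ⟨i, hi, 0, M0, add_zero i⟩
  have hadd : ∀ x ∈ I + M, ∀ y ∈ I + M, x + y ∈ I + M := by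
    rintro _ ⟨i, hi, m, hm, rfl⟩ _ ⟨j, hj, n, hn, rfl⟩
    exact ⟨i + j, Iadd i hi j hj, m + n, Madd m hm n hn, add_add_add_comm i j m n⟩
  have hmul : ∀ x ∈ I + M, ∀ a, a * x ∈ I + M ∧ x * a ∈ I + M := by
    rintro _ ⟨i, hi, m, hm, rfl⟩ a
    obtain ⟨hi₁, hi₂⟩ := Imul i hi a trivial
    obtain ⟨hm₁, hm₂⟩ := Mmul m hm a trivial
    exact ⟨⟨_, hi₁, _, hm₁, (mul_add a i m).symm⟩, ⟨_, hi₂, _, hm₂, (add_mul i m a).symm⟩⟩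
  have hneg : ∀ x ∈ I + M, -x ∈ I + M := by
    rintro _ ⟨i, hi, m, hm, rfl⟩
    exact ⟨-i, Ineg i hi, -m, Mneg m hm, (neg_add i m).symm⟩
  refine relUnit_mem_of_dense hadd (fun x hx a => (hmul x hx a).1)
    (fun x => hM_sub (he.2 x trivial).1) ?_
  refine (hmax _ (isIdealOf_closure (hI_sub I0) hadd hneg hmul)
    (hM_sub.trans subset_closure)).resolve_left fun h => hIM ?_
  exact h ▸ hI_sub.trans subset_closure

/-- A modular maximal ideal not containing the ideal `J` has a relative unit in `J`. -/
theorem exists_relUnit_mem {J M : Set A} (hJ : IsIdealOf J (Set.univ : Set A))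
    (hM : IsModMaxIdealOf M (Set.univ : Set A)) (hJM : ¬ J ⊆ M) :
    ∃ e ∈ J, IsRelUnitMod Set.univ M e := by
  obtain ⟨e, he⟩ := hM.2.2.2
  obtain ⟨j, hj, m, hm, rfl⟩ := relUnit_mem_add hJ hM he hJM
  obtain ⟨⟨-, -, -, Madd, -, Mmul⟩, -⟩ := hM
  refine ⟨j, hj, trivial, fun x _ => ?_⟩
  obtain ⟨h₁, h₂⟩ := he.2 x trivial
  obtain ⟨h₃, h₄⟩ := Mmul m hm x trivial
  constructor
  · convert Madd _ h₁ _ h₃ using 1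
    rw [mul_add]; abel
  · convert Madd _ h₂ _ h₄ using 1
    rw [add_mul]; abel

/-- Modular maximal ideals of `A` not containing `J` restrict to modular maximal ideals of `J`. -/
theorem isModMaxIdealOf_inter {J M : Set A} (hJ : IsIdealOf J (Set.univ : Set A))
    (hM : IsModMaxIdealOf M (Set.univ : Set A)) (hJM : ¬ J ⊆ M) :
    IsModMaxIdealOf (M ∩ J) J := by
  obtain ⟨e, heJ, he⟩ := exists_relUnit_mem hJ hM hJM
  obtain ⟨-, Jclosed, J0, Jadd, Jneg, Jmul⟩ := hJ
  have Jsub : ∀ x ∈ J, ∀ y ∈ J, x - y ∈ J := fun x hx y hy =>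
    sub_eq_add_neg x y ▸ Jadd x hx _ (Jneg y hy)
  obtain ⟨-, Mclosed, M0, Madd, Mneg, Mmul⟩ := hM.1
  refine ⟨⟨Set.inter_subset_right, Mclosed.inter Jclosed, ⟨M0, J0⟩,
    fun x hx y hy => ⟨Madd x hx.1 y hy.1, Jadd x hx.2 y hy.2⟩,
    fun x hx => ⟨Mneg x hx.1, Jneg x hx.2⟩,
    fun x hx a _ => ⟨⟨(Mmul x hx.1 a trivial).1, (Jmul x hx.2 a trivial).1⟩,
      ⟨(Mmul x hx.1 a trivial).2, (Jmul x hx.2 a trivial).2⟩⟩⟩,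
    fun h => hJM (Set.inter_eq_right.1 h), fun I hI hMI => ?_,
    e, heJ, fun x hx => ⟨⟨(he.2 x trivial).1, Jsub x hx _ (Jmul e heJ x trivial).1⟩,
      ⟨(he.2 x trivial).2, Jsub x hx _ (Jmul e heJ x trivial).2⟩⟩⟩
  obtain ⟨hIJ, Iclosed, I0, Iadd, Ineg, Imul⟩ := hI
  have hIA : IsIdealOf I (Set.univ : Set A) := by
    refine ⟨Set.subset_univ _, Iclosed, I0, Iadd, Ineg, fun x hx a _ => ⟨?_, ?_⟩⟩
    · have h₁ : (e * a) * x ∈ I := (Imul x hx _ (Jmul e heJ a trivial).2).1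
      have h₂ : (a - e * a) * x ∈ I := hMI
        ⟨(Mmul _ (he.2 a trivial).2 x trivial).2, (Jmul x (hIJ hx) _ trivial).1⟩
      convert Iadd _ h₁ _ h₂ using 1
      rw [sub_mul]; abel
    · have h₁ : x * (a * e) ∈ I := (Imul x hx _ (Jmul e heJ a trivial).1).2
      have h₂ : x * (a - a * e) ∈ I := hMI
        ⟨(Mmul _ (he.2 a trivial).1 x trivial).1, (Jmul x (hIJ hx) _ trivial).2⟩
      convert Iadd _ h₁ _ h₂ using 1
      rw [mul_sub]; abel
  by_cases hIM : I ⊆ M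
  · exact .inl ((Set.subset_inter hIM hIJ).antisymm hMI)
  obtain ⟨i, hi, m, hm, hime⟩ := relUnit_mem_add hIA hM he hIM
  have heI : e ∈ I := by
    have hmJ : m ∈ J := by
      rw [eq_sub_of_add_eq' hime]
      exact Jsub e heJ i (hIJ hi)
    rw [← hime]
    exact Iadd i hi m (hMI ⟨hm, hmJ⟩)
  refine .inr (hIJ.antisymm fun x hx => ?_)
  have h₁ : x - x * e ∈ I := hMI
    ⟨(he.2 x trivial).1, Jsub x hx _ (Jmul e heJ x trivial).1⟩
  convert Iadd _ h₁ _ (Imul e heI x hx).1 using 1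
  abel

/-- The centre of an ideal of a C*-algebra is contained in the centre of the algebra. -/
theorem centerOf_ideal_subset {J : Set A} (hJ : IsIdealOf J (Set.univ : Set A)) :
    centerOf J ⊆ centerOf (Set.univ : Set A) := by
  rintro z ⟨hzJ, hz⟩
  obtain ⟨-, -, -, Jadd, Jneg, Jmul⟩ := hJ
  refine ⟨trivial, fun a _ => ?_⟩
  have hann : ∀ j ∈ J, j * (z * a - a * z) = 0 := fun j hj => by
    rw [mul_sub, ← mul_assoc, ← mul_assoc, ← hz j hj, mul_assoc,
      hz _ (Jmul j hj a trivial).2, sub_self]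
  have hdJ : z * a - a * z ∈ J := sub_eq_add_neg (z * a) (a * z) ▸
    Jadd _ (Jmul z hzJ a trivial).2 _ (Jneg _ (Jmul z hzJ a trivial).1)
  set d := z * a - a * z
  have h : star (star d * d) * (star d * d) = 0 := by
    rw [star_mul, star_star, mul_assoc, ← mul_assoc d,
      hann _ (Jmul d hdJ (star d) trivial).2, mul_zero]
  exact sub_eq_zero.1 <| CStarRing.star_mul_self_eq_zero_iff _ |>.1 <|
    CStarRing.star_mul_self_eq_zero_iff _ |>.1 h

theorem subset_of_inter_subset {J M N : Set A} (hJ : IsIdealOf J (Set.univ : Set A))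
    (hM : IsModMaxIdealOf M (Set.univ : Set A)) (hN : IsModMaxIdealOf N (Set.univ : Set A))
    (hJN : ¬ J ⊆ N) (h : M ∩ J ⊆ N) : M ⊆ N := by
  obtain ⟨e, heJ, he⟩ := exists_relUnit_mem hJ hN hJN
  intro x hx
  have hxe : x * e ∈ N := h
    ⟨(hM.1.2.2.2.2.2 x hx e trivial).2, (hJ.2.2.2.2.2 e heJ x trivial).1⟩
  convert hN.1.2.2.2.1 _ (he.2 x trivial).1 _ hxe using 1
  abel

end WeaklyCentralIdeals

/-- **Lemma 3.15.** Every weakly central ideal `J` of a C*-algebra `A` is contained in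
`ker T_A`, the intersection of all members of `T_A`. -/
theorem stmt6 {A : Type*} [NonUnitalCStarAlgebra A] (J : Set A)
    (hJ : IsIdealOf J (Set.univ : Set A)) (hwc : WeaklyCentral J) :
    J ⊆ ⋂₀ Tset (Set.univ : Set A) := by
  refine Set.subset_sInter fun M hMT => ?_
  obtain ⟨hM, hMT⟩ := hMT
  by_contra hJM
  have hMJ := isModMaxIdealOf_inter hJ hM hJM
  have hZ := centerOf_ideal_subset hJ
  obtain ⟨z, hz, hzMJ⟩ := Set.not_subset.1 (hwc.1 _ hMJ)
  have hzM : z ∉ M := fun h => hzMJ ⟨h, hz.1⟩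
  obtain h | ⟨N, hN, hNM, -, -, hMN⟩ := hMT
  · exact hzM (h (hZ hz))
  have mem_iff : ∀ y ∈ centerOf J, (y ∈ M ↔ y ∈ N) := fun y hy =>
    ⟨fun h => (hMN.subset ⟨h, hZ hy⟩).1, fun h => (hMN.symm.subset ⟨h, hZ hy⟩).1⟩
  have hJN : ¬ J ⊆ N := fun h => hzM ((mem_iff z hz).2 (h hz.1))
  have hinter : M ∩ J = N ∩ J := by
    refine hwc.2 _ _ hMJ (isModMaxIdealOf_inter hJ hN hJN) (Set.ext fun y => ?_)
    have := mem_iff y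
    simp only [Set.mem_inter_iff]
    tauto
  refine hNM (subset_of_inter_subset hJ hN hM hJM ?_ |>.antisymm <|
    subset_of_inter_subset hJ hM hN hJN ?_)
  · exact hinter ▸ Set.inter_subset_left
  · exact hinter ▸ Set.inter_subset_left
end

section
/- A C*-algebra A has the centre-quotient (CQ) property if and only if there exists an ideal J of A such that both J and A/J have the CQ-property and Z(A/J) = (Z(A)+J)/J. -/
open Filter Topology Pointwise

open CQP

namespace CQP

/-- The additive subgroup underlying an ideal. -/
def IsIdealOf.toAddSubgroup {R : Type*} [NonUnitalRing R] [TopologicalSpace R] {I S : Set R}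
    (h : IsIdealOf I S) : AddSubgroup R where
  carrier := I
  zero_mem' := h.2.2.1
  add_mem' := fun {x y} hx hy => h.2.2.2.1 x hx y hy
  neg_mem' := fun {x} hx => h.2.2.2.2.1 x hx

section

variable {A : Type*} [NonUnitalCStarAlgebra A]

lemma mul_one_sub_sq_le {δ : ℝ} (hδ : 0 < δ) (t : ℝ) :
    t * (1 - t * (t / (t ^ 2 + δ ^ 2))) ^ 2 ≤ δ := by
  have hp : 0 < t ^ 2 + δ ^ 2 := by positivity
  have h1 : 1 - t * (t / (t ^ 2 + δ ^ 2)) = δ ^ 2 / (t ^ 2 + δ ^ 2) := by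
    field_simp
    ring
  rw [h1, div_pow, mul_div_assoc', div_le_iff₀ (by positivity)]
  have h2 : t * δ ≤ t ^ 2 + δ ^ 2 := by nlinarith [sq_nonneg (t - δ), sq_nonneg t]
  have h3 : δ ^ 2 ≤ t ^ 2 + δ ^ 2 := by nlinarith [sq_nonneg t]
  calc t * (δ ^ 2) ^ 2 = δ * ((t * δ) * δ ^ 2) := by ring
    _ ≤ δ * ((t ^ 2 + δ ^ 2) * (t ^ 2 + δ ^ 2)) := by gcongr
    _ = δ * (t ^ 2 + δ ^ 2) ^ 2 := by ring

lemma sub_cfcₙ_mul_mul_star_self (j : A) {F : ℝ → ℝ} (hF : Continuous F) (hF0 : F 0 = 0) :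
    (j - cfcₙ F (j * star j) * j) * star (j - cfcₙ F (j * star j) * j)
      = cfcₙ (fun t : ℝ => t * (1 - F t) ^ 2) (j * star j) := by
  have hsa : IsSelfAdjoint (j * star j) := .mul_star_self j
  have hstar : star (cfcₙ F (j * star j)) = cfcₙ F (j * star j) :=
    (cfcₙ_predicate F (j * star j) : IsSelfAdjoint _)
  have hG : Continuous fun t : ℝ => t - F t * t := by fun_prop
  have hG0 : (fun t : ℝ => t - F t * t) 0 = 0 := by simp
  have h1 : (fun t : ℝ => t * (1 - F t) ^ 2)
      = fun t => (t - F t * t) - (t - F t * t) * F t := by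
    ext t; ring
  have h2 : cfcₙ (fun t : ℝ => t - F t * t) (j * star j)
      = j * star j - cfcₙ F (j * star j) * (j * star j) := by
    rw [cfcₙ_sub (fun t : ℝ => t) (fun t => F t * t) (j * star j) continuousOn_id rfl
        (by fun_prop) (by simp),
      cfcₙ_mul F (fun t => t) (j * star j) hF.continuousOn hF0 continuousOn_id rfl,
      cfcₙ_id' ℝ (j * star j)]
  rw [h1, cfcₙ_sub (fun t : ℝ => t - F t * t) (fun t => (t - F t * t) * F t) (j * star j)
      hG.continuousOn hG0 (hG.mul hF).continuousOn (by simp),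
    cfcₙ_mul (fun t : ℝ => t - F t * t) F (j * star j) hG.continuousOn hG0 hF.continuousOn hF0, h2]
  simp only [star_sub, star_mul, hstar]
  noncomm_ring

/-- Every element `j` of a C*-algebra is approximately fixed by a contraction in the right ideal
generated by `j * star j`. -/
lemma exists_contraction_approx (j : A) {ε : ℝ} (hε : 0 < ε) :
    ∃ b : A, ‖j * star j * b‖ ≤ 1 ∧ ‖j - j * star j * b * j‖ ≤ ε := by
  let := CStarAlgebra.spectralOrder A
  have := CStarAlgebra.spectralOrderedRing A
  have hsa : IsSelfAdjoint (j * star j) := .mul_star_self j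
  let g : ℝ → ℝ := fun t => t / (t ^ 2 + (ε ^ 2) ^ 2)
  have hg : Continuous g :=
    continuous_id.div (by fun_prop) fun t => (by positivity : t ^ 2 + (ε ^ 2) ^ 2 ≠ 0)
  have hg0 : g 0 = 0 := by simp [g]
  have hfe : cfcₙ (fun t : ℝ => t * g t) (j * star j) = j * star j * cfcₙ g (j * star j) := by
    rw [cfcₙ_mul (fun t : ℝ => t) g (j * star j) continuousOn_id rfl hg.continuousOn hg0,
      cfcₙ_id' ℝ (j * star j)]
  refine ⟨cfcₙ g (j * star j), ?_, ?_⟩ <;> rw [← hfe]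
  · refine norm_cfcₙ_le fun t _ => ?_
    have : t * g t = t ^ 2 / (t ^ 2 + (ε ^ 2) ^ 2) := by simp only [g]; ring
    rw [this, Real.norm_of_nonneg (by positivity), div_le_one (by positivity)]
    exact le_add_of_nonneg_right (by positivity)
  · refine (sq_le_sq₀ (norm_nonneg _) hε.le).1 ?_
    rw [sq, ← CStarRing.norm_self_mul_star,
      sub_cfcₙ_mul_mul_star_self j (F := fun t => t * g t) (continuous_id.mul hg) (by simp)]
    refine norm_cfcₙ_le fun t ht => ?_
    have ht0 : 0 ≤ t := quasispectrum_nonneg_of_nonneg _ (mul_star_self_nonneg j) t ht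
    rw [Real.norm_of_nonneg (by positivity)]
    exact mul_one_sub_sq_le (by positivity) t

/-- The sum of two closed ideals of a C*-algebra is closed. -/
lemma isClosed_sup {I J : Set A} (hI : IsIdealOf I Set.univ) (hJ : IsIdealOf J Set.univ) :
    IsClosed ((hI.toAddSubgroup ⊔ hJ.toAddSubgroup : AddSubgroup A) : Set A) := by
  set I' := hI.toAddSubgroup
  set J' := hJ.toAddSubgroup
  have : CompleteSpace I' := hI.2.1.completeSpace_coe
  have : CompleteSpace J' := hJ.2.1.completeSpace_coe
  let f : NormedAddGroupHom (I' × J') A :=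
    (I'.subtype.coprod J'.subtype).mkNormedAddGroupHom 2 fun p => by
      change ‖(p.1 : A) + p.2‖ ≤ 2 * ‖p‖
      have h1 : ‖(p.1 : A)‖ ≤ ‖p‖ := norm_fst_le p
      have h2 : ‖(p.2 : A)‖ ≤ ‖p‖ := norm_snd_le p
      linarith [norm_add_le (p.1 : A) p.2]
  have hf : f.SurjectiveOnWith (I' ⊔ J') 4 := by
    intro u hu
    obtain ⟨i, hi, j, hj, rfl⟩ := AddSubgroup.mem_sup.1 hu
    rcases eq_or_ne (i + j) 0 with h0 | h0
    · exact ⟨0, by simp [h0], by simp⟩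
    obtain ⟨b, hb1, hb2⟩ := exists_contraction_approx j (norm_pos_iff.2 h0)
    set e := j * star j * b
    have heJ : e ∈ J :=
      (hJ.2.2.2.2.2 _ (hJ.2.2.2.2.2 j hj (star j) trivial).2 b trivial).2
    have hei : e * i ∈ I := (hI.2.2.2.2.2 i hi e trivial).1
    have hei' : e * i ∈ J := (hJ.2.2.2.2.2 e heJ i trivial).2
    have hn : ‖i - e * i‖ ≤ 3 * ‖i + j‖ := by
      have h1 : i - e * i = (i + j) - e * (i + j) - (j - e * j) := by noncomm_ring
      have h2 : ‖e * (i + j)‖ ≤ ‖i + j‖ :=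
        (norm_mul_le _ _).trans (mul_le_of_le_one_left (norm_nonneg _) hb1)
      rw [h1]
      linarith [norm_sub_le ((i + j) - e * (i + j)) (j - e * j),
        norm_sub_le (i + j) (e * (i + j))]
    have hm : ‖j + e * i‖ ≤ 4 * ‖i + j‖ := by
      have h1 : j + e * i = (i + j) - (i - e * i) := by abel
      rw [h1]
      linarith [norm_sub_le (i + j) (i - e * i)]
    refine ⟨(⟨i - e * i, I'.sub_mem hi hei⟩, ⟨j + e * i, J'.add_mem hj hei'⟩), ?_, ?_⟩
    · change (i - e * i) + (j + e * i) = i + j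
      abel
    · exact max_le (hn.trans (by linarith [norm_nonneg (i + j)])) hm
  refine isClosed_of_closure_subset fun x hx => ?_
  obtain ⟨p, rfl, -⟩ := controlled_closure_of_complete (by norm_num) one_pos hf x hx
  exact AddSubgroup.add_mem_sup p.1.2 p.2.2

lemma isIdealOf_sup {I J : Set A} (hI : IsIdealOf I Set.univ) (hJ : IsIdealOf J Set.univ) :
    IsIdealOf ((hI.toAddSubgroup ⊔ hJ.toAddSubgroup : AddSubgroup A) : Set A) Set.univ := by
  refine ⟨Set.subset_univ _, isClosed_sup hI hJ, zero_mem _, fun x hx y hy => add_mem hx hy,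
    fun x hx => neg_mem hx, fun x hx a _ => ?_⟩
  obtain ⟨i, hi, j, hj, rfl⟩ := AddSubgroup.mem_sup.1 hx
  obtain ⟨hi1, hi2⟩ := hI.2.2.2.2.2 i hi a trivial
  obtain ⟨hj1, hj2⟩ := hJ.2.2.2.2.2 j hj a trivial
  rw [mul_add, add_mul]
  exact ⟨AddSubgroup.add_mem_sup hi1 hj1, AddSubgroup.add_mem_sup hi2 hj2⟩

lemma IsIdealOf.centerOf_subset {J : Set A} (hJ : IsIdealOf J Set.univ) :
    centerOf J ⊆ centerOf Set.univ := by
  refine fun z hz => ⟨trivial, fun a _ => ?_⟩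
  obtain ⟨hzJ, hz⟩ := hz
  -- The commutator `z * a - a * z` annihilates `J` on the right, and lies in `J`.
  have hann : ∀ y ∈ J, (z * a - a * z) * y = 0 := fun y hy => by
    rw [sub_mul, mul_assoc, mul_assoc, hz _ (hJ.2.2.2.2.2 y hy a trivial).1, hz y hy, mul_assoc,
      sub_self]
  have hcJ : z * a - a * z ∈ J := by
    obtain ⟨h1, h2⟩ := hJ.2.2.2.2.2 z hzJ a trivial
    exact hJ.toAddSubgroup.sub_mem h2 h1
  set c := z * a - a * z
  have h1 : c * star c * star (c * star c) = 0 := by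
    rw [star_mul, star_star, mul_assoc,
      ← mul_assoc (star c), hann _ (hJ.2.2.2.2.2 _
        (hJ.2.2.2.2.2 c hcJ (star c) trivial).1 (star c) trivial).2]
  exact sub_eq_zero.1 ((CStarRing.mul_star_self_eq_zero_iff c).1
    ((CStarRing.mul_star_self_eq_zero_iff _).1 h1))

end

end CQP

/-- **Theorem 3.16 (i) ⇔ (v).** A C*-algebra `A` has the CQ-property if and only if
there is an ideal `J` of `A` such that both `J` and `A/J` have the CQ-property and
`Z(A/J) = (Z(A)+J)/J` (i.e. every element of `A` that is central modulo `J` lifts to a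
central element of `A` modulo `J`). -/
theorem stmt7 {A : Type*} [NonUnitalCStarAlgebra A] :
    HasCQ (Set.univ : Set A) ↔
      ∃ J : Set A, IsIdealOf J (Set.univ : Set A) ∧ HasCQ J ∧ HasCQmod J ∧
        (∀ a : A, (∀ x : A, a * x - x * a ∈ J) →
          ∃ z ∈ centerOf (Set.univ : Set A), a - z ∈ J) := by
  refine ⟨fun h => ⟨Set.univ, ?_, h, ?_, ?_⟩, ?_⟩
  · exact ⟨subset_rfl, isClosed_univ, trivial, fun _ _ _ _ => trivial, fun _ _ => trivial,
      fun _ _ _ _ => ⟨trivial, trivial⟩⟩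
  · exact fun I _ hI a _ => ⟨a, fun _ => trivial, hI trivial⟩
  · exact fun a _ => ⟨0, ⟨trivial, by simp⟩, trivial⟩
  · rintro ⟨J, hJ, hcqJ, hmod, hlift⟩ I hI a - ha
    obtain ⟨w, hwJ, haw⟩ := hmod _ (isIdealOf_sup hI hJ)
      (fun x hx => AddSubgroup.mem_sup_right (x := x) (T := hJ.toAddSubgroup) hx) a
      (fun x => AddSubgroup.mem_sup_left (S := hI.toAddSubgroup) (ha x trivial))
    obtain ⟨z, hz, hwz⟩ := hlift w hwJ
    obtain ⟨i, hi, j, hj, hij⟩ := AddSubgroup.mem_sup.1 haw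
    have hmul := hJ.2.2.2.2.2
    have hadd := hJ.2.2.2.1
    -- `k` is the component in `J` of `a - z`, which is central modulo `I`.
    set k := j + (w - z)
    have hk : k ∈ J := hadd _ hj _ hwz
    have hak : a - z - k = i := by
      rw [sub_eq_iff_eq_add.1 hij.symm]
      simp only [k]
      abel
    have hIJ : IsIdealOf (I ∩ J) J := by
      refine ⟨Set.inter_subset_right, hI.2.1.inter hJ.2.1, ⟨hI.2.2.1, hJ.2.2.1⟩,
        fun x hx y hy => ⟨hI.2.2.2.1 x hx.1 y hy.1, hadd x hx.2 y hy.2⟩,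
        fun x hx => ⟨hI.2.2.2.2.1 x hx.1, hJ.2.2.2.2.1 x hx.2⟩, fun x hx b _ => ?_⟩
      obtain ⟨h1, h2⟩ := hI.2.2.2.2.2 x hx.1 b trivial
      obtain ⟨h3, h4⟩ := hmul x hx.2 b trivial
      exact ⟨⟨h1, h3⟩, ⟨h2, h4⟩⟩
    obtain ⟨y, hy, hky⟩ := hcqJ _ hIJ k hk fun x hx => by
      constructor
      · obtain ⟨h1, h2⟩ := hI.2.2.2.2.2 i hi x trivial
        have h3 : k * x - x * k = (a * x - x * a) - (i * x - x * i) := by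
          rw [← hak]
          simp only [sub_mul, mul_sub, hz.2 x trivial]
          abel
        rw [h3]
        exact hI.toAddSubgroup.sub_mem (ha x trivial) (hI.toAddSubgroup.sub_mem h2 h1)
      · exact hJ.toAddSubgroup.sub_mem (hmul k hk x trivial).2 (hmul k hk x trivial).1
    have hy' := hJ.centerOf_subset hy
    refine ⟨z + y, ⟨trivial, fun x _ => ?_⟩, ?_⟩
    · rw [add_mul, mul_add, hz.2 x trivial, hy'.2 x trivial]
    · have : a - (z + y) = i + (k - y) := by
        rw [← hak]
        abel
      rw [this]
      exact hI.2.2.2.1 _ hi _ hky.1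
end
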